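/- arXiv:1804.05137 — 12 statements merged into one kernel-verified Lean document; each statement's English description precedes it below -/
import Mathlib

section
/- Let s, t, k, v be positive integers with s < t ≤ k. There exists an augmented orthogonal array AOA(s,t,k,v) if and only if there exists an s-resolvable orthogonal array OA(t,k,v), i.e., an OA(t,k,v) whose rows can be partitioned into v^{t-s} subarrays each of which is an OA(s,k,v). -/
/-- An orthogonal array OA(t,k,v): a `v^t × k` array with entries from `Fin v`
such that in any `t` columns every `t`-tuple appears exactly once among the rows. -/
def IsOA (t k v : ℕ) (A : Fin (v ^ t) → Fin k → Fin v) : Prop :=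
  ∀ c : Fin t → Fin k, Function.Injective c →
    Function.Bijective fun r : Fin (v ^ t) => fun i : Fin t => A r (c i)

/-- An augmented orthogonal array AOA(s,t,k,v): the first `k` columns `A` form an
OA(t,k,v), the last column `L` has entries from a set of size `v^(t-s)`, and any `s`
of the first `k` columns together with the last column contain every `(s+1)`-tuple
exactly once. -/
def IsAOA (s t k v : ℕ) (A : Fin (v ^ t) → Fin k → Fin v)
    (L : Fin (v ^ t) → Fin (v ^ (t - s))) : Prop :=
  IsOA t k v A ∧
    ∀ c : Fin s → Fin k, Function.Injective c →
      Function.Bijective fun r : Fin (v ^ t) =>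
        ((fun i : Fin s => A r (c i)), L r)

/-- Existence of an AOA(s,t,k,v). -/
def ExistsAOA (s t k v : ℕ) : Prop := ∃ A L, IsAOA s t k v A L

/-- An `s`-resolvable OA(t,k,v): an OA(t,k,v) whose rows are partitioned (via `P`)
into `v^(t-s)` subarrays, each of which is an OA(s,k,v). -/
def IsResolvableOA (s t k v : ℕ) (A : Fin (v ^ t) → Fin k → Fin v)
    (P : Fin (v ^ t) → Fin (v ^ (t - s))) : Prop :=
  IsOA t k v A ∧
    ∀ (y : Fin (v ^ (t - s))) (c : Fin s → Fin k), Function.Injective c →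
      Function.Bijective fun r : { r : Fin (v ^ t) // P r = y } =>
        fun i : Fin s => A r.1 (c i)

/-- Pairing with `g` gives a bijection if and only if `f` is bijective on every fibre of `g`. -/
theorem bijective_prodMk_iff_forall_fiber {α β γ : Type*} (f : α → β) (g : α → γ) :
    (Function.Bijective fun a => (f a, g a)) ↔
      ∀ y, Function.Bijective fun a : { a // g a = y } => f a.1 := by
  constructor
  · rintro ⟨hinj, hsurj⟩ y
    refine ⟨fun a b hab => Subtype.ext (hinj (Prod.ext hab (a.2.trans b.2.symm))), fun x => ?_⟩
    obtain ⟨a, ha⟩ := hsurj (x, y)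
    exact ⟨⟨a, congrArg Prod.snd ha⟩, congrArg Prod.fst ha⟩
  · intro h
    constructor
    · intro a b hab
      have hg : g a = g b := congrArg Prod.snd hab
      have hfib : (⟨a, hg⟩ : { c // g c = g b }) = ⟨b, rfl⟩ :=
        (h (g b)).1 (congrArg Prod.fst hab)
      exact congrArg Subtype.val hfib
    · rintro ⟨x, y⟩
      obtain ⟨⟨a, rfl⟩, rfl⟩ := (h y).2 x
      exact ⟨a, rfl⟩

theorem isAOA_iff_isResolvableOA {s t k v : ℕ} (A : Fin (v ^ t) → Fin k → Fin v)
    (L : Fin (v ^ t) → Fin (v ^ (t - s))) :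
    IsAOA s t k v A L ↔ IsResolvableOA s t k v A L := by
  simp only [IsAOA, IsResolvableOA, bijective_prodMk_iff_forall_fiber]
  exact and_congr_right fun _ => ⟨fun h y c hc => h c hc y, fun h c hc y => h y c hc⟩

theorem aoa_iff_resolvable_oa (s t k v : ℕ) (hs : 0 < s) (hst : s < t) (htk : t ≤ k)
    (hv : 0 < v) :
    ExistsAOA s t k v ↔ ∃ A P, IsResolvableOA s t k v A P := by
  simp only [ExistsAOA, isAOA_iff_isResolvableOA]
end

section
/- Let s, t, k, u, v be positive integers with s < t ≤ k. If there exists an AOA(s,t,k,v) and an AOA(s,t,k,u), then there exists an AOA(s,t,k,uv). -/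
/-- The mixed-radix bijection between `Fin ((u * v) ^ n)` and `Fin (u ^ n) × Fin (v ^ n)`. -/
def finMulPowEquiv (u v n : ℕ) : Fin ((u * v) ^ n) ≃ Fin (u ^ n) × Fin (v ^ n) :=
  (finCongr (mul_pow u v n)).trans finProdFinEquiv.symm

/-- Pairs of tuples correspond to tuples of pairs. -/
def tupleProdEquiv {ι X Y Z : Type*} (p : X × Y ≃ Z) : (ι → X) × (ι → Y) ≃ (ι → Z) :=
  (Equiv.arrowProdEquivProdArrow ι (fun _ => X) (fun _ => Y)).symm.trans
    (Equiv.arrowCongr (Equiv.refl ι) p)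

theorem IsOA.product {t k u v : ℕ} {A : Fin (u ^ t) → Fin k → Fin u}
    {B : Fin (v ^ t) → Fin k → Fin v} (hA : IsOA t k u A) (hB : IsOA t k v B) :
    IsOA t k (u * v) fun r j =>
      finProdFinEquiv (A (finMulPowEquiv u v t r).1 j, B (finMulPowEquiv u v t r).2 j) :=
  fun c hc => (tupleProdEquiv finProdFinEquiv).bijective.comp
    (((hA c hc).prodMap (hB c hc)).comp (finMulPowEquiv u v t).bijective)

theorem IsAOA.product {s t k u v : ℕ} {A : Fin (u ^ t) → Fin k → Fin u}
    {L : Fin (u ^ t) → Fin (u ^ (t - s))} {B : Fin (v ^ t) → Fin k → Fin v}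
    {M : Fin (v ^ t) → Fin (v ^ (t - s))} (hA : IsAOA s t k u A L) (hB : IsAOA s t k v B M) :
    IsAOA s t k (u * v)
      (fun r j =>
        finProdFinEquiv (A (finMulPowEquiv u v t r).1 j, B (finMulPowEquiv u v t r).2 j))
      (fun r => (finMulPowEquiv u v (t - s)).symm
        (L (finMulPowEquiv u v t r).1, M (finMulPowEquiv u v t r).2)) :=
  ⟨hA.1.product hB.1, fun c hc =>
    ((Equiv.prodProdProdComm _ _ _ _).trans
      (Equiv.prodCongr (tupleProdEquiv finProdFinEquiv)
        (finMulPowEquiv u v (t - s)).symm)).bijective.comp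
      (((hA.2 c hc).prodMap (hB.2 c hc)).comp (finMulPowEquiv u v t).bijective)⟩

theorem aoa_product (s t k u v : ℕ) (hs : 0 < s) (hst : s < t) (htk : t ≤ k)
    (hu : 0 < u) (hv : 0 < v)
    (h1 : ExistsAOA s t k v) (h2 : ExistsAOA s t k u) :
    ExistsAOA s t k (u * v) := by
  obtain ⟨B, M, hB⟩ := h1
  obtain ⟨A, L, hA⟩ := h2
  exact ⟨_, _, hA.product hB⟩
end

section
/- Let v, s, t, k be positive integers with 1 ≤ s < t ≤ k. If every prime divisor of v is at least k, then there exists an AOA(s,t,k,v). -/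
/-- Evaluation of coefficient vectors at points with pairwise unit differences is injective. -/
lemma Matrix.vandermonde_mulVec_injective {R : Type*} [CommRing R] {n : ℕ} (x : Fin n → R)
    (hx : ∀ i j, i ≠ j → IsUnit (x i - x j)) :
    Function.Injective (Matrix.vandermonde x).mulVec := by
  apply Matrix.mulVec_injective_of_isUnit
  rw [Matrix.isUnit_iff_isUnit_det, Matrix.det_vandermonde]
  refine (IsUnit.prod_iff).2 fun i _ => (IsUnit.prod_iff).2 fun j hj => ?_
  exact hx j i (Finset.mem_Ioi.1 hj).ne'

/-- If every prime divisor of `v` is at least `k`, then `0, …, k - 1` have pairwise unit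
differences modulo `v`. -/
lemma ZMod.isUnit_sub_of_large_prime_divisors {v k : ℕ}
    (hp : ∀ p : ℕ, p.Prime → p ∣ v → k ≤ p) (i j : Fin k) (hij : i ≠ j) :
    IsUnit (((i : ℕ) : ZMod v) - ((j : ℕ) : ZMod v)) := by
  wlog h : j < i generalizing i j
  · rw [← neg_sub]
    exact (this j i hij.symm (lt_of_le_of_ne (not_lt.1 h) hij)).neg
  have hji : (j : ℕ) < i := h
  rw [← Nat.cast_sub hji.le, ZMod.isUnit_iff_coprime]
  refine Nat.coprime_of_dvd fun p hpp hpd hpv => ?_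
  have h₁ := hp p hpp hpv
  have h₂ := Nat.le_of_dvd (by omega) hpd
  omega

theorem aoa_of_large_prime_divisors (v s t k : ℕ) (hv : 0 < v)
    (hs : 1 ≤ s) (hst : s < t) (htk : t ≤ k)
    (hp : ∀ p : ℕ, p.Prime → p ∣ v → k ≤ p) :
    ExistsAOA s t k v := by
  have : NeZero v := ⟨hv.ne'⟩
  obtain ⟨u, rfl⟩ := Nat.exists_eq_add_of_le hst.le
  let e : Fin (v ^ (s + u)) ≃ (Fin (s + u) → ZMod v) :=
    (Fintype.equivFinOfCardEq (by simp [ZMod.card])).symm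
  let f : ZMod v ≃ Fin v := Fintype.equivFinOfCardEq (ZMod.card v)
  let g : (Fin u → ZMod v) ≃ Fin (v ^ (s + u - s)) :=
    Fintype.equivFinOfCardEq (by simp [ZMod.card])
  let x : Fin k → ZMod v := fun j => ((j : ℕ) : ZMod v)
  have hx : ∀ {n : ℕ} (c : Fin n → Fin k), Function.Injective c →
      Function.Injective (Matrix.vandermonde (x ∘ c)).mulVec := fun c hc =>
    Matrix.vandermonde_mulVec_injective _ fun i j hij =>
      ZMod.isUnit_sub_of_large_prime_divisors hp _ _ (hc.ne hij)
  refine ⟨fun r j => f (∑ m : Fin (s + u), x j ^ (m : ℕ) * e r m),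
    fun r => g fun m => e r (Fin.natAdd s m), fun c hc => ?_, fun c hc => ?_⟩
  · refine (Fintype.bijective_iff_injective_and_card _).2 ⟨fun a b hab => ?_, by simp⟩
    refine e.injective (hx c hc (funext fun i => ?_))
    simpa [Matrix.mulVec, dotProduct, Matrix.vandermonde_apply] using congrFun hab i
  · refine (Fintype.bijective_iff_injective_and_card _).2
      ⟨fun a b hab => ?_, by simp [pow_add]⟩
    obtain ⟨hA, hL⟩ := Prod.mk.inj hab
    have high : ∀ m, e a (Fin.natAdd s m) = e b (Fin.natAdd s m) := congrFun (g.injective hL)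
    have low : (fun m => e a (Fin.castAdd u m)) = fun m => e b (Fin.castAdd u m) := by
      refine hx c hc (funext fun i => ?_)
      have h := f.injective (congrFun hA i)
      simp only [Fin.sum_univ_add, high] at h
      simpa [Matrix.mulVec, dotProduct, Matrix.vandermonde_apply] using h
    refine e.injective (funext fun m => ?_)
    exact Fin.addCases (congrFun low) high m
end

section
/- Let v and k be positive integers with v ≢ 2 (mod 4) and k ≥ 3. Then there exists an AOA(1, k−1, k, v). -/
/-- An injection from `Fin n` to `Fin (n + 1)` misses at most one point. -/
theorem exists_forall_ne_mem_range {n : ℕ} (c : Fin n → Fin (n + 1))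
    (hc : Function.Injective c) : ∃ p, ∀ j, j ≠ p → ∃ i, c i = j := by
  have h : ((Finset.univ.image c)ᶜ).card = 1 := by
    rw [Finset.card_compl, Finset.card_image_of_injective _ hc]
    simp
  obtain ⟨p, hp⟩ := Finset.card_eq_one.mp h
  refine ⟨p, fun j hj => ?_⟩
  have : j ∉ (Finset.univ.image c)ᶜ := by rw [hp]; simpa using hj
  simpa using this

/-- Extension of a vector by one last coordinate making the sum of the coordinates zero. -/
def zeroSumExtend {R : Type*} [CommRing R] {n : ℕ} (r : Fin n → R) : Fin (n + 1) → R :=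
  Fin.snoc r (-∑ i, r i)

theorem sum_zeroSumExtend {R : Type*} [CommRing R] {n : ℕ} (r : Fin n → R) :
    ∑ j, zeroSumExtend r j = 0 := by
  simp [zeroSumExtend, Fin.sum_univ_castSucc]

theorem zeroSumExtend_injective {R : Type*} [CommRing R] {n : ℕ} :
    Function.Injective (zeroSumExtend : (Fin n → R) → Fin (n + 1) → R) := fun r s h => by
  funext i
  simpa [zeroSumExtend] using congrFun h i.castSucc

theorem zeroSumExtend_eq_of_forall_ne {R : Type*} [CommRing R] {n : ℕ} {r s : Fin n → R}
    (p : Fin (n + 1)) (h : ∀ j, j ≠ p → zeroSumExtend r j = zeroSumExtend s j) : r = s := by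
  apply zeroSumExtend_injective
  have hs : ∑ j, (zeroSumExtend r j - zeroSumExtend s j) = 0 := by
    simp [sum_zeroSumExtend]
  rw [Finset.sum_eq_single p (fun j _ hj => by rw [h j hj, sub_self]) (by simp)] at hs
  funext j
  by_cases hj : j = p
  · rw [hj]; exact sub_eq_zero.mp hs
  · exact h j hj

/-- The label of the coset of `R ∙ u` containing a zero-sum vector, where `u` has zero sum. -/
def cosetLabel {R : Type*} [CommRing R] {m : ℕ} (u : Fin (m + 2) → Rˣ) (r : Fin (m + 1) → R) :
    Fin m → R :=
  fun j => ↑(u j.succ.castSucc)⁻¹ * r j.succ - ↑(u 0)⁻¹ * r 0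

theorem eq_of_cosetLabel_eq {R : Type*} [CommRing R] {m : ℕ} {u : Fin (m + 2) → Rˣ}
    (hu : ∑ j, (u j : R) = 0) {r s : Fin (m + 1) → R} (hL : cosetLabel u r = cosetLabel u s)
    (i : Fin (m + 2)) (hi : zeroSumExtend r i = zeroSumExtend s i) : r = s := by
  set t : R := ↑(u 0)⁻¹ * (r 0 - s 0) with ht
  have hinit : ∀ j : Fin (m + 1), r j - s j = u j.castSucc * t := by
    intro j
    refine Fin.cases ?_ (fun j => ?_) j
    · simp [ht]
    · have h := congrFun hL j
      simp only [cosetLabel] at h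
      have h' : t = ↑(u j.succ.castSucc)⁻¹ * (r j.succ - s j.succ) := by
        rw [ht]; linear_combination -h
      rw [h', Units.mul_inv_cancel_left]
  have hall : ∀ j, zeroSumExtend r j - zeroSumExtend s j = u j * t := by
    intro j
    refine Fin.lastCases ?_ (fun j => ?_) j
    · have h : ∑ j : Fin (m + 1), (r j - s j) = ∑ j : Fin (m + 1), (u j.castSucc : R) * t :=
        Finset.sum_congr rfl fun j _ => hinit j
      rw [Finset.sum_sub_distrib, ← Finset.sum_mul] at h
      rw [Fin.sum_univ_castSucc] at hu
      simp only [zeroSumExtend, Fin.snoc_last]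
      linear_combination -h - t * hu
    · simpa [zeroSumExtend] using hinit j
  have h0 : t = 0 := by
    have h := hall i
    rw [hi, sub_self] at h
    exact ((u i).mul_right_eq_zero).mp h.symm
  funext j
  have h := hinit j
  rw [h0, mul_zero] at h
  exact sub_eq_zero.mp h

/-- Units with zero sum in a finite commutative ring of order `v` give an AOA. -/
theorem existsAOA_of_units {R : Type*} [CommRing R] [Fintype R] {v m : ℕ}
    (hR : Fintype.card R = v) (u : Fin (m + 2) → Rˣ) (hu : ∑ j, (u j : R) = 0) :
    ExistsAOA 1 (m + 1) (m + 2) v := by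
  classical
  let e : R ≃ Fin v := Fintype.equivFinOfCardEq hR
  let row : (Fin (m + 1) → R) ≃ Fin (v ^ (m + 1)) :=
    Fintype.equivFinOfCardEq (by simp [hR])
  let lab : (Fin m → R) ≃ Fin (v ^ m) := Fintype.equivFinOfCardEq (by simp [hR])
  refine ⟨fun r j => e (zeroSumExtend (row.symm r) j), fun r => lab (cosetLabel u (row.symm r)),
    fun c hc => ?_, fun c _ => ?_⟩
  · rw [Fintype.bijective_iff_injective_and_card]
    refine ⟨fun r s h => ?_, by simp⟩
    obtain ⟨p, hp⟩ := exists_forall_ne_mem_range c hc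
    refine row.symm.injective (zeroSumExtend_eq_of_forall_ne p fun j hj => ?_)
    obtain ⟨i, rfl⟩ := hp j hj
    exact e.injective (congrFun h i)
  · rw [Fintype.bijective_iff_injective_and_card]
    refine ⟨fun r s h => ?_, by simp [pow_succ']⟩
    rw [Prod.mk.injEq] at h
    exact row.symm.injective (eq_of_cosetLabel_eq hu (lab.injective h.2) (c 0)
      (e.injective (congrFun h.1 0)))

/-- Three units with zero sum yield zero-sum families of units of every length at least two. -/
theorem exists_units_sum_eq_zero {R : Type*} [CommRing R] {a b c : Rˣ}
    (h : (a + b + c : R) = 0) : ∀ m, ∃ u : Fin (m + 2) → Rˣ, ∑ j, (u j : R) = 0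
  | 0 => ⟨![1, -1], by simp [Fin.sum_univ_two]⟩
  | 1 => ⟨![a, b, c], by simpa [Fin.sum_univ_three] using h⟩
  | m + 2 => by
    obtain ⟨u, hu⟩ := exists_units_sum_eq_zero h m
    exact ⟨Fin.cons 1 (Fin.cons (-1) u), by simp [Fin.sum_univ_succ (n := m + 3),
      Fin.sum_univ_succ (n := m + 2), hu]⟩

theorem exists_three_units_zmod {n : ℕ} (hn : Odd n) :
    ∃ a b c : (ZMod n)ˣ, (a + b + c : ZMod n) = 0 :=
  ⟨1, 1, -ZMod.unitOfCoprime 2 (Nat.coprime_two_left.mpr hn), by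
    push_cast [ZMod.coe_unitOfCoprime]; ring⟩

theorem exists_three_units_field {F : Type*} [Field F] [Fintype F] (hF : 2 < Fintype.card F) :
    ∃ a b c : Fˣ, (a + b + c : F) = 0 := by
  classical
  obtain ⟨x, hx⟩ : ∃ x, x ∉ ({0, -1} : Finset F) := by
    by_contra! h
    have := Finset.card_le_card (fun x _ => h x : Finset.univ ⊆ ({0, -1} : Finset F))
    have := Finset.card_le_two (a := (0 : F)) (b := -1)
    rw [Finset.card_univ] at *
    omega
  simp only [Finset.mem_insert, Finset.mem_singleton, not_or] at hx
  have h1 : 1 + x ≠ 0 := fun h => hx.2 (by linear_combination h)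
  exact ⟨1, Units.mk0 x hx.1, -Units.mk0 (1 + x) h1, by simp⟩

theorem exists_three_units_prod {R S : Type*} [CommRing R] [CommRing S]
    (hR : ∃ a b c : Rˣ, (a + b + c : R) = 0) (hS : ∃ a b c : Sˣ, (a + b + c : S) = 0) :
    ∃ a b c : (R × S)ˣ, (a + b + c : R × S) = 0 := by
  obtain ⟨a, b, c, h⟩ := hR
  obtain ⟨a', b', c', h'⟩ := hS
  exact ⟨MulEquiv.prodUnits.symm (a, a'), MulEquiv.prodUnits.symm (b, b'),
    MulEquiv.prodUnits.symm (c, c'), Prod.ext h h'⟩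

theorem aoa_one_km1_k (v k : ℕ) (hv : 0 < v) (hv4 : v % 4 ≠ 2) (hk : 3 ≤ k) :
    ExistsAOA 1 (k - 1) k v := by
  obtain ⟨m, rfl⟩ : ∃ m, k = m + 2 := ⟨k - 2, by omega⟩
  change ExistsAOA 1 (m + 1) (m + 2) v
  obtain ⟨a, n, hn, rfl⟩ := Nat.exists_eq_two_pow_mul_odd hv.ne'
  have : NeZero n := ⟨hn.pos.ne'⟩
  obtain rfl | rfl | ha : a = 0 ∨ a = 1 ∨ 2 ≤ a := by omega
  · obtain ⟨x, y, z, h⟩ := exists_three_units_zmod hn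
    obtain ⟨u, hu⟩ := exists_units_sum_eq_zero h m
    exact existsAOA_of_units (by simp [ZMod.card]) u hu
  · obtain ⟨l, rfl⟩ := hn
    omega
  · have hF : Nat.card (GaloisField 2 a) = 2 ^ a := GaloisField.card 2 a (by omega)
    let _ : Fintype (GaloisField 2 a) := Fintype.ofFinite _
    rw [Nat.card_eq_fintype_card] at hF
    have h4 : 2 ^ 2 ≤ 2 ^ a := Nat.pow_le_pow_right (by norm_num) ha
    obtain ⟨x, y, z, h⟩ := exists_three_units_prod
      (exists_three_units_field (F := GaloisField 2 a) (by omega)) (exists_three_units_zmod hn)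
    obtain ⟨u, hu⟩ := exists_units_sum_eq_zero h m
    exact existsAOA_of_units (by rw [Fintype.card_prod, hF, ZMod.card]) u hu
end

section
/- Let v and k be positive integers with k even and k ≥ 4. Then there exists an AOA(1, k−1, k, v). (Equivalently, the zero-sum orthogonal array OA(k−1,k,v) over Z_v, consisting of all k-tuples (x_1,…,x_k) ∈ Z_v^k with x_1+⋯+x_k ≡ 0 (mod v), is resolvable.) -/
/-- Two families with the same sum that agree on all but at most one index are equal. -/
theorem eq_of_sum_eq_of_comp_eq {G : Type*} [AddCommGroup G] {n : ℕ} {f g : Fin (n + 1) → G}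
    (hsum : ∑ i, f i = ∑ i, g i) {c : Fin n → Fin (n + 1)} (hc : Function.Injective c)
    (h : ∀ i, f (c i) = g (c i)) : f = g := by
  funext j
  by_cases hj : j ∈ Set.range c
  · obtain ⟨i, rfl⟩ := hj
    exact h i
  · have hb : Function.Bijective (Fin.cons j c : Fin (n + 1) → Fin (n + 1)) :=
      Finite.injective_iff_bijective.mp (Fin.cons_injective_iff.mpr ⟨hj, hc⟩)
    rw [← hb.sum_comp f, ← hb.sum_comp g, Fin.sum_univ_succ, Fin.sum_univ_succ] at hsum
    simpa [h] using hsum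

/-- The word `(d, -∑ d, 0)` translated by `a` times the alternating word `(1, -1, 1, -1, …)`. -/
def alternatingTranslate {R : Type*} [CommRing R] {n : ℕ} (p : (Fin n → R) × R) :
    Fin (n + 2) → R := fun i =>
  Fin.snoc (α := fun _ => R) (Fin.snoc (α := fun _ => R) p.1 (-∑ j, p.1 j)) 0 i +
    (-1) ^ (i : ℕ) * p.2

theorem sum_alternatingTranslate {R : Type*} [CommRing R] {n : ℕ} (hn : Even n)
    (p : (Fin n → R) × R) : ∑ i, alternatingTranslate p i = 0 := by
  have hn2 : Even (n + 2) := hn.add even_two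
  simp only [alternatingTranslate, Finset.sum_add_distrib, ← Finset.sum_mul,
    Fin.sum_neg_one_pow, if_pos hn2]
  simp [Fin.sum_univ_castSucc]

theorem alternatingTranslate_injective {R : Type*} [CommRing R] {n : ℕ} :
    Function.Injective (alternatingTranslate (R := R) (n := n)) := by
  rintro ⟨d, a⟩ ⟨d', a'⟩ h
  have ha : a = a' := by
    have hlast := congrFun h (Fin.last (n + 1))
    simp only [alternatingTranslate, Fin.snoc_last, zero_add] at hlast
    exact ((isUnit_one.neg).pow _).mul_left_cancel hlast
  subst ha
  refine Prod.ext (funext fun i => ?_) rfl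
  simpa [alternatingTranslate] using congrFun h i.castSucc.castSucc

/-- The label `d` and any one entry determine an alternating translate. -/
theorem alternatingTranslate_apply_injective {R : Type*} [CommRing R] {n : ℕ}
    (i : Fin (n + 2)) :
    Function.Injective fun p : (Fin n → R) × R => (alternatingTranslate p i, p.1) := by
  rintro ⟨d, a⟩ ⟨d', a'⟩ h
  obtain ⟨hi, rfl : d = d'⟩ := Prod.mk.inj h
  simp only [alternatingTranslate, add_right_inj] at hi
  exact Prod.ext rfl (((isUnit_one.neg).pow _).mul_left_cancel hi)

theorem aoa_one_km1_k_of_even (v k : ℕ) (hv : 0 < v) (hk : Even k) (hk4 : 4 ≤ k) :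
    ExistsAOA 1 (k - 1) k v := by
  obtain ⟨n, rfl⟩ : ∃ n, k = n + 2 := ⟨k - 2, by omega⟩
  have hn : Even n := by simpa [Nat.even_add] using hk
  have : NeZero v := ⟨hv.ne'⟩
  let eX : ZMod v ≃ Fin v := Fintype.equivFinOfCardEq (ZMod.card v)
  let eL : (Fin n → ZMod v) ≃ Fin (v ^ n) := Fintype.equivFinOfCardEq (by simp)
  let eR : (Fin n → ZMod v) × ZMod v ≃ Fin (v ^ (n + 1)) :=
    Fintype.equivFinOfCardEq (by simp [pow_succ])
  refine ⟨fun r i => eX (alternatingTranslate (eR.symm r) i), fun r => eL (eR.symm r).1,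
    fun c hc => ?_, fun c _ => ?_⟩
  · refine (Fintype.bijective_iff_injective_and_card _).mpr ⟨fun r r' h => ?_, by simp⟩
    refine eR.symm.injective (alternatingTranslate_injective ?_)
    refine eq_of_sum_eq_of_comp_eq ?_ hc fun i => eX.injective (congrFun h i)
    rw [sum_alternatingTranslate hn, sum_alternatingTranslate hn]
  · refine (Fintype.bijective_iff_injective_and_card _).mpr
      ⟨fun r r' h => ?_, by simp [pow_succ, mul_comm]⟩
    obtain ⟨hc, hL⟩ := Prod.mk.inj h
    exact eR.symm.injective (alternatingTranslate_apply_injective (c 0)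
      (Prod.ext (eX.injective (congrFun hc 0)) (eL.injective hL)))
end

section
/- Let s, t, v be positive integers with s < t. If there exists an OA(s,t,v), then there exists an AOA(s,t,t,v). -/
/-- Existence of an OA(t,k,v). -/
def ExistsOA (t k v : ℕ) : Prop := ∃ A, IsOA t k v A

/-- The array listing all `t`-tuples is an OA(t,t,v). -/
theorem isOA_of_equiv {t v : ℕ} (e : Fin (v ^ t) ≃ (Fin t → Fin v)) : IsOA t t v e := by
  intro c hc
  rw [Fintype.bijective_iff_injective_and_card]
  refine ⟨fun r r' h => e.injective ?_, by simp⟩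
  funext i
  obtain ⟨j, rfl⟩ := (Finite.injective_iff_surjective.mp hc) i
  exact congrFun h j

theorem aoa_of_oa (s t v : ℕ) (hs : 0 < s) (hst : s < t) (hv : 0 < v)
    (h : ExistsOA s t v) :
    ExistsAOA s t t v := by
  obtain ⟨B, hB⟩ := h
  have : NeZero v := ⟨hv.ne'⟩
  let e : Fin (v ^ t) ≃ (Fin t → Fin v) := finFunctionFinEquiv.symm
  -- Each tuple determines the row of `B` with the same first `s` entries.
  let g : Fin (v ^ s) ≃ (Fin s → Fin v) :=
    Equiv.ofBijective _ (hB (Fin.castLE hst.le) (Fin.castLE_injective _))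
  let row (w : Fin t → Fin v) : Fin (v ^ s) := g.symm fun i => w (Fin.castLE hst.le i)
  have hrow (w : Fin t → Fin v) (i : Fin s) :
      B (row w) (Fin.castLE hst.le i) = w (Fin.castLE hst.le i) :=
    congrFun (g.apply_symm_apply fun i => w (Fin.castLE hst.le i)) i
  -- The label of a tuple is its difference from that row on the last `t - s` columns.
  let label (w : Fin t → Fin v) : Fin (t - s) → Fin v := fun j =>
    w ⟨s + j, by omega⟩ - B (row w) ⟨s + j, by omega⟩
  refine ⟨e, fun r => finFunctionFinEquiv (label (e r)), isOA_of_equiv e, fun c hc => ?_⟩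
  rw [Fintype.bijective_iff_injective_and_card]
  refine ⟨fun r r' h => e.injective ?_, by simp [← pow_add, Nat.add_sub_cancel' hst.le]⟩
  obtain ⟨hcol, hlabel⟩ := Prod.mk.inj h
  have hdiff (i : Fin t) : e r i - B (row (e r)) i = e r' i - B (row (e r')) i := by
    by_cases hi : i.val < s
    · have h₁ : B (row (e r)) i = e r i := hrow (e r) ⟨i, hi⟩
      have h₂ : B (row (e r')) i = e r' i := hrow (e r') ⟨i, hi⟩
      rw [h₁, h₂, sub_self, sub_self]
    · have hj := congrFun (finFunctionFinEquiv.injective hlabel) ⟨i - s, by omega⟩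
      have hi' : (⟨s + (i - s), by omega⟩ : Fin t) = i := Fin.ext (by simp; omega)
      simpa only [label, hi'] using hj
  have hrows : row (e r) = row (e r') := by
    refine (hB c hc).injective (funext fun i => ?_)
    have := hdiff (c i)
    rw [show e r (c i) = e r' (c i) from congrFun hcol i] at this
    exact sub_right_injective this
  funext i
  have := hdiff i
  rw [hrows] at this
  exact sub_left_injective this
end

section
/- Suppose q is a prime power and 1 ≤ s < k ≤ q+1. Then there exists an AOA(s,k,k,q). -/
/-- The points of the projective line over `F`, in homogeneous coordinates. -/
def projCoords {F : Type*} [Field F] : Option F → F × F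
  | some a => (a, 1)
  | none => (1, 0)

theorem projCoords_cross_ne_zero {F : Type*} [Field F] {x y : Option F} (h : x ≠ y) :
    (projCoords y).1 * (projCoords x).2 - (projCoords x).1 * (projCoords y).2 ≠ 0 := by
  rcases x with _ | a <;> rcases y with _ | b <;>
    simp_all [projCoords, sub_eq_zero, eq_comm]

/-- Distinct points of the projective line give an invertible projective Vandermonde matrix. -/
theorem det_projVandermonde_projCoords_ne_zero {F : Type*} [Field F] {m : ℕ}
    (p : Fin m → Option F) (hp : Function.Injective p) :
    (Matrix.projVandermonde (fun i => (projCoords (p i)).1)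
      (fun i => (projCoords (p i)).2)).det ≠ 0 := by
  rw [Matrix.det_projVandermonde]
  refine Finset.prod_ne_zero_iff.2 fun i _ => Finset.prod_ne_zero_iff.2 fun j hj => ?_
  exact projCoords_cross_ne_zero (hp.ne (Finset.mem_Ioi.1 hj).ne)

/-- A codeword of an extended Reed–Solomon code that vanishes on `k - m` coordinates is zero. -/
theorem eq_zero_of_vecMul_rectVandermonde_projCoords {F : Type*} [Field F] {s k m : ℕ}
    (hm : m = k - s) {p : Fin k → Option F} (hp : Function.Injective p)
    {c : Fin s → Fin k} (hc : Function.Injective c) {d : Fin k → F}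
    (hd : ∀ i, d (c i) = 0) (h : Matrix.vecMul d (Matrix.rectVandermonde (fun i => (projCoords (p i)).1)
      (fun i => (projCoords (p i)).2) m) = 0) : d = 0 := by
  have hcard : (Finset.univ.image c)ᶜ.card = m := by
    rw [Finset.card_compl, Finset.card_image_of_injective _ hc]
    simp [hm]
  set f := (Finset.univ.image c)ᶜ.orderEmbOfFin hcard with hf
  have hrange : ∀ i, i ∉ Set.range f → d i = 0 := by
    intro i hi
    rw [hf, Finset.range_orderEmbOfFin] at hi
    obtain ⟨j, rfl⟩ : ∃ j, c j = i := by simpa using hi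
    exact hd j
  have hdf : d ∘ f = 0 := by
    refine Matrix.eq_zero_of_vecMul_eq_zero
      (det_projVandermonde_projCoords_ne_zero (p ∘ f) (hp.comp f.injective)) ?_
    ext j
    rw [← h]
    refine Fintype.sum_of_injective f f.injective _ _ (fun i hi => ?_) fun i => ?_
    · simp [hrange i hi]
    · simp [Matrix.projVandermonde_apply, Matrix.rectVandermonde_apply]
  ext i
  by_cases hi : i ∈ Set.range f
  · obtain ⟨j, rfl⟩ := hi
    exact congrFun hdf j
  · exact hrange i hi

/-- An AOA(s,k,k,q) from a finite field with `q` elements. -/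
theorem existsAOA_of_field {F : Type*} [Field F] [Fintype F] {q s k : ℕ}
    (hF : Fintype.card F = q) (hsk : s < k) (hk : k ≤ q + 1) : ExistsAOA s k k q := by
  classical
  obtain ⟨p⟩ : Nonempty (Fin k ↪ Option F) :=
    Function.Embedding.nonempty_of_card_le (by simpa [hF] using hk)
  let e : F ≃ Fin q := Fintype.equivFinOfCardEq hF
  let rows : Fin (q ^ k) ≃ (Fin k → F) :=
    (Fintype.equivFinOfCardEq (by simp [hF])).symm
  let labels : (Fin (k - s) → F) ≃ Fin (q ^ (k - s)) :=
    Fintype.equivFinOfCardEq (by simp [hF])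
  refine ⟨fun r i => e (rows r i),
    fun r => labels (Matrix.vecMul (rows r) (Matrix.rectVandermonde
      (fun i => (projCoords (p i)).1) (fun i => (projCoords (p i)).2) (k - s))),
    fun c hc => (Fintype.bijective_iff_injective_and_card _).2 ⟨fun x y hxy => ?_, by simp⟩,
    fun c hc => (Fintype.bijective_iff_injective_and_card _).2 ⟨fun x y hxy => ?_, ?_⟩⟩
  · refine rows.injective (funext fun i => ?_)
    obtain ⟨j, rfl⟩ := (Finite.injective_iff_surjective.1 hc) i
    exact e.injective (congrFun hxy j)
  · obtain ⟨h₁, h₂⟩ := Prod.mk.inj hxy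
    refine rows.injective (sub_eq_zero.1 ?_)
    refine eq_zero_of_vecMul_rectVandermonde_projCoords rfl p.injective hc (fun i => ?_) ?_
    · exact sub_eq_zero.2 (e.injective (congrFun h₁ i))
    · rw [Matrix.sub_vecMul, sub_eq_zero]
      exact labels.injective h₂
  · simp [← pow_add, Nat.add_sub_of_le hsk.le]

theorem aoa_s_k_k_prime_power (q s k : ℕ) (hq : IsPrimePow q)
    (hs : 1 ≤ s) (hsk : s < k) (hk : k ≤ q + 1) :
    ExistsAOA s k k q := by
  obtain ⟨p, n, hp, hn, rfl⟩ := (isPrimePow_nat_iff q).1 hq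
  have : Fact p.Prime := ⟨hp⟩
  have : Fintype (GaloisField p n) := Fintype.ofFinite _
  refine existsAOA_of_field (F := GaloisField p n) ?_ hsk hk
  rw [← Nat.card_eq_fintype_card, GaloisField.card p n hn.ne']
end

section
/- For every odd integer n ≥ 5, there exists an AOA(1,3,5,n). -/
/-- A commutative group `G` has a `(|G|, 4; 1)`-difference matrix: four maps `G → G`
whose pairwise differences are injective. -/
def HasDifferenceMatrix (G : Type*) [AddCommGroup G] : Prop :=
  ∃ d : Fin 4 → G → G, ∀ i j, i ≠ j → Function.Injective fun x => d i x - d j x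

theorem HasDifferenceMatrix.prod {G H : Type*} [AddCommGroup G] [AddCommGroup H]
    (hG : HasDifferenceMatrix G) (hH : HasDifferenceMatrix H) :
    HasDifferenceMatrix (G × H) := by
  obtain ⟨d, hd⟩ := hG
  obtain ⟨e, he⟩ := hH
  refine ⟨fun i x => (d i x.1, e i x.2), fun i j hij x y hxy => ?_⟩
  simp only [Prod.mk_sub_mk, Prod.mk.injEq] at hxy
  exact Prod.ext (hd i j hij hxy.1) (he i j hij hxy.2)

theorem hasDifferenceMatrix_of_isUnit_sub {R : Type*} [CommRing R] (c : Fin 4 → R)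
    (hc : ∀ i j, i ≠ j → IsUnit (c i - c j)) : HasDifferenceMatrix R := by
  refine ⟨fun i x => c i * x, fun i j hij x y hxy => ?_⟩
  simp only [← sub_mul] at hxy
  exact (hc i j hij).mul_left_cancel hxy

theorem hasDifferenceMatrix_of_field {F : Type*} [Field F] [Finite F] (hF : 4 ≤ Nat.card F) :
    HasDifferenceMatrix F := by
  have := Fintype.ofFinite F
  obtain ⟨c⟩ : Nonempty (Fin 4 ↪ F) :=
    Function.Embedding.nonempty_of_card_le (by simpa [Nat.card_eq_fintype_card] using hF)
  exact hasDifferenceMatrix_of_isUnit_sub c fun i j hij =>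
    (sub_ne_zero.mpr (c.injective.ne hij)).isUnit

theorem isUnit_fin_four_sub {m : ℕ} (hm : m.Coprime 6) (i j : Fin 4) (hij : i ≠ j) :
    IsUnit ((i.val : ZMod m) - (j.val : ZMod m)) := by
  have h2 : IsUnit ((2 : ℕ) : ZMod m) :=
    (ZMod.isUnit_iff_coprime 2 m).mpr (hm.coprime_dvd_right (by norm_num)).symm
  have h3 : IsUnit ((3 : ℕ) : ZMod m) :=
    (ZMod.isUnit_iff_coprime 3 m).mpr (hm.coprime_dvd_right (by norm_num)).symm
  have key : ∀ i j : Fin 4, i < j → IsUnit ((j.val : ZMod m) - (i.val : ZMod m)) := by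
    intro i j hij
    rw [← Nat.cast_sub hij.le]
    obtain h | h | h : j.val - i.val = 1 ∨ j.val - i.val = 2 ∨ j.val - i.val = 3 := by omega
    · simp [h]
    · rwa [h]
    · rwa [h]
  rcases lt_or_gt_of_ne hij with h | h
  · rw [← neg_sub]
    exact (key i j h).neg
  · exact key j i h

theorem hasDifferenceMatrix_zmod {m : ℕ} (hm : m.Coprime 6) : HasDifferenceMatrix (ZMod m) :=
  hasDifferenceMatrix_of_isUnit_sub (fun i => (i.val : ZMod m)) (isUnit_fin_four_sub hm)

/-- The arcs of a digraph on `0, …, 11`: the cycle `0 → 1 → 2 → 0`, the cycle `3 → ⋯ → 7 → 3`,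
arcs `2 → 3`, `7 → 0` between them, and a path `2 → 8 → ⋯ → 11 → 0`. -/
def WalkStep (p q : ℕ) : Prop :=
  (q = p + 1 ∧ p ≠ 2 ∧ p ≠ 7 ∧ p ≠ 11) ∨ (p = 2 ∧ (q = 0 ∨ q = 3 ∨ q = 8)) ∨
    (p = 7 ∧ (q = 0 ∨ q = 3)) ∨ (p = 11 ∧ q = 0)

instance (p q : ℕ) : Decidable (WalkStep p q) := by
  unfold WalkStep
  infer_instance

theorem exists_closed_walk {m : ℕ} [NeZero m] (hm : 5 ≤ m) (hm3 : ¬ 3 ∣ m) :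
    ∃ f : ZMod m → Fin 12, ∀ y, WalkStep (f y) (f (y + 1)) := by
  obtain ⟨g, hg, hstep, hlast⟩ : ∃ g : ℕ → ℕ, (∀ y < m, g y < 12) ∧
      (∀ y, y + 1 < m → WalkStep (g y) (g (y + 1))) ∧ WalkStep (g (m - 1)) (g 0) := by
    obtain h | h : m % 3 = 1 ∨ m % 3 = 2 := by omega
    · refine ⟨fun y => if y + 4 < m then y % 3 else y + 12 - m, ?_, ?_, ?_⟩
      · intro y hy
        dsimp only
        split_ifs <;> omega
      · intro y hy
        unfold WalkStep
        dsimp only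
        split_ifs <;> omega
      · unfold WalkStep
        dsimp only
        split_ifs <;> omega
    · refine ⟨fun y => if y + 5 < m then y % 3 else y + 8 - m, ?_, ?_, ?_⟩
      · intro y hy
        dsimp only
        split_ifs <;> omega
      · intro y hy
        unfold WalkStep
        dsimp only
        split_ifs <;> omega
      · unfold WalkStep
        dsimp only
        split_ifs <;> omega
  refine ⟨fun y => ⟨g y.val, hg _ y.val_lt⟩, fun y => ?_⟩
  have hy := y.val_lt
  by_cases h : y.val + 1 < m
  · have hval : (y + 1).val = y.val + 1 := by
      have : Fact (1 < m) := ⟨by omega⟩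
      rw [ZMod.val_add_of_lt (by rwa [ZMod.val_one]), ZMod.val_one]
    simpa [hval] using hstep _ h
  · have hym : y.val = m - 1 := by omega
    have h0 : y + 1 = 0 := by
      rw [← ZMod.natCast_zmod_val y, hym, ← Nat.cast_add_one, Nat.sub_add_cancel (by omega),
        ZMod.natCast_self]
    simpa [h0, hym] using hlast

/-- The label of the vertex `q` at the layer `a` and the row `i`. -/
def label (q : Fin 12) (a : Fin 3) (i : Fin 4) : Fin 3 :=
  (![![![0, 0, 2, 0], ![0, 1, 1, 2], ![0, 2, 0, 1]],
    ![![0, 0, 1, 0], ![0, 1, 0, 2], ![0, 2, 2, 1]],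
    ![![0, 0, 0, 0], ![0, 1, 2, 2], ![0, 2, 1, 1]],
    ![![0, 0, 2, 0], ![0, 1, 1, 2], ![0, 2, 0, 1]],
    ![![0, 0, 1, 0], ![0, 1, 0, 2], ![0, 2, 2, 1]],
    ![![0, 1, 1, 1], ![0, 1, 2, 0], ![0, 0, 2, 2]],
    ![![0, 0, 0, 0], ![0, 1, 0, 2], ![0, 2, 0, 1]],
    ![![0, 2, 2, 2], ![0, 0, 1, 1], ![0, 2, 1, 0]],
    ![![0, 1, 0, 1], ![0, 1, 1, 0], ![0, 0, 1, 2]],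
    ![![0, 1, 0, 2], ![0, 1, 2, 0], ![0, 2, 2, 1]],
    ![![0, 2, 0, 0], ![0, 0, 2, 1], ![0, 2, 2, 2]],
    ![![0, 0, 0, 0], ![0, 0, 1, 1], ![0, 2, 1, 2]]] : Fin 12 → Fin 3 → Fin 4 → Fin 3) q a i

/-- The position, in a window of five consecutive vertices, at which the layer `a` is read when
comparing two rows with index sum `b`. -/
def windowPos (a : Fin 3) (b : ℕ) : ℕ :=
  if a = 0 then 2 else if a = 1 then 5 - b else b - 1

/-- In the window `q`, the row differences read at distinct layers are distinct. -/
def WindowSeparated (q : List (Fin 12)) : Prop :=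
  ∀ i j : Fin 4, i ≠ j → ∀ a a' : Fin 3, a ≠ a' →
    label (q.getD (windowPos a (i + j)) 0) a i - label (q.getD (windowPos a (i + j)) 0) a j ≠
      label (q.getD (windowPos a' (i + j)) 0) a' i - label (q.getD (windowPos a' (i + j)) 0) a' j

instance (q : List (Fin 12)) : Decidable (WindowSeparated q) := by
  unfold WindowSeparated
  infer_instance

theorem windowSeparated_of_walk : ∀ q₀ q₁ : Fin 12, WalkStep q₀ q₁ →
    ∀ q₂ : Fin 12, WalkStep q₁ q₂ → ∀ q₃ : Fin 12, WalkStep q₂ q₃ →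
    ∀ q₄ : Fin 12, WalkStep q₃ q₄ → WindowSeparated [q₀, q₁, q₂, q₃, q₄] := by
  decide +kernel

theorem hasDifferenceMatrix_three_prod {m : ℕ} (hm : m.Coprime 6) (hm5 : 5 ≤ m) :
    HasDifferenceMatrix (Fin 3 × ZMod m) := by
  have : NeZero m := ⟨by omega⟩
  have hm3 : ¬ 3 ∣ m := fun h =>
    absurd (Nat.dvd_gcd h (show 3 ∣ 6 by norm_num)) (by rw [hm]; norm_num)
  obtain ⟨f, hf⟩ := exists_closed_walk hm5 hm3
  let t : Fin 3 → ZMod m := ![0, 1, -1]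
  refine ⟨fun i x => (label (f x.2) x.1 i,
    (i.val : ZMod m) * x.2 + t x.1 * ((i.val : ZMod m) * i.val - 3 * i.val)), ?_⟩
  rintro i j hij ⟨a, y⟩ ⟨a', y'⟩ h
  simp only [Prod.mk_sub_mk, Prod.mk.injEq] at h
  obtain ⟨hl, hr⟩ := h
  have hshift : y + t a * (i.val + j.val - 3) = y' + t a' * (i.val + j.val - 3) := by
    refine (isUnit_fin_four_sub hm i j hij).mul_left_cancel ?_
    linear_combination hr
  have hpos : ∀ b : Fin 3, (windowPos b (i + j) : ZMod m) = 2 - t b * (i.val + j.val - 3) := by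
    intro b
    have h1 : 1 ≤ i.val + j.val := by omega
    have h5 : i.val + j.val ≤ 5 := by omega
    fin_cases b
    · simp [windowPos, t]
    · simp [windowPos, t, Nat.cast_sub h5]
      ring
    · simp [windowPos, t, Nat.cast_sub h1]
      ring
  have hlt : ∀ b : Fin 3, windowPos b (i + j) < 5 := by
    intro b
    unfold windowPos
    split_ifs <;> omega
  obtain ⟨x, hx⟩ : ∃ x, x = y + t a * (i.val + j.val - 3) - 2 := ⟨_, rfl⟩
  have hy : y = x + (windowPos a (i + j) : ℕ) := by
    rw [hpos, hx]
    ring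
  have hy' : y' = x + (windowPos a' (i + j) : ℕ) := by
    rw [hpos, hx, hshift]
    ring
  have haa : a = a' := by
    by_contra hne
    have hwin : ∀ k < 5, [f x, f (x + 1), f (x + 1 + 1), f (x + 1 + 1 + 1),
        f (x + 1 + 1 + 1 + 1)].getD k 0 = f (x + (k : ℕ)) := by
      intro k hk
      interval_cases k <;> simp [add_assoc] <;> norm_num
    have := windowSeparated_of_walk _ _ (hf x) _ (hf _) _ (hf _) _ (hf _) i j hij a a' hne
    rw [hwin _ (hlt a), hwin _ (hlt a'), ← hy, ← hy'] at this
    exact this hl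
  subst haa
  rw [hy, hy']

theorem three_distinct_of_five (P : Fin 5 → Prop) (c : Fin 3 → Fin 5) (hc : Function.Injective c)
    (hP : ∀ i, P (c i)) :
    (P 0 ∧ P 1 ∧ (P 2 ∨ P 3 ∨ P 4)) ∨ (P 2 ∧ P 3 ∧ (P 0 ∨ P 1 ∨ P 4)) ∨
      ((P 0 ∨ P 1) ∧ (P 2 ∨ P 3) ∧ P 4) := by
  have h01 : c 0 ≠ c 1 := hc.ne (by decide)
  have h02 : c 0 ≠ c 2 := hc.ne (by decide)
  have h12 : c 1 ≠ c 2 := hc.ne (by decide)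
  have h0 := hP 0
  have h1 := hP 1
  have h2 := hP 2
  generalize c 0 = x at *
  generalize c 1 = y at *
  generalize c 2 = z at *
  fin_cases x <;> fin_cases y <;> fin_cases z <;> simp_all

/-- An augmented orthogonal array `AOA(1,3,5,n)` indexed by arbitrary types of the right
cardinalities. -/
theorem existsAOA_of_types {n : ℕ} {R X Y : Type*} [Finite R] [Finite X] [Finite Y]
    (hR : Nat.card R = n ^ 3) (hX : Nat.card X = n) (hY : Nat.card Y = n ^ 2)
    (A : R → Fin 5 → X) (L : R → Y)
    (hA : ∀ c : Fin 3 → Fin 5, Function.Injective c →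
      Function.Injective fun r => fun i => A r (c i))
    (hL : ∀ k, Function.Injective fun r => (A r k, L r)) : ExistsAOA 1 3 5 n := by
  let eR := Finite.equivFinOfCardEq hR
  let eX := Finite.equivFinOfCardEq hX
  let eY := Finite.equivFinOfCardEq hY
  refine ⟨fun r k => eX (A (eR.symm r) k), fun r => eY (L (eR.symm r)), fun c hc => ?_,
    fun c _ => ?_⟩
  · rw [Fintype.bijective_iff_injective_and_card]
    refine ⟨fun r r' h => eR.symm.injective (hA c hc ?_), by simp⟩
    funext i
    exact eX.injective (congrFun h i)
  · rw [Fintype.bijective_iff_injective_and_card]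
    refine ⟨fun r r' h => eR.symm.injective (hL (c 0) ?_), by simp [pow_succ, mul_assoc]⟩
    have h' := Prod.ext_iff.mp h
    exact Prod.ext (eX.injective (congrFun h'.1 0)) (eY.injective h'.2)

theorem HasDifferenceMatrix.existsAOA {G : Type*} [AddCommGroup G] [Finite G]
    (hG : HasDifferenceMatrix G) (hodd : Odd (Nat.card G)) : ExistsAOA 1 3 5 (Nat.card G) := by
  obtain ⟨d, hd⟩ := hG
  have hdouble : ∀ u v : G, u + u = v + v → u = v := by
    intro u v huv
    have hcop : (Nat.card G).Coprime 2 := hodd.coprime_two_right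
    refine (Nat.Coprime.nsmul_right_bijective hcop).injective ?_
    simpa only [two_nsmul] using huv
  refine existsAOA_of_types (R := G × G × G) (X := G) (Y := G × G)
    (by simp only [Nat.card_prod]; ring) rfl (by simp only [Nat.card_prod]; ring)
    (fun r => ![r.1 + d 0 r.2.2, r.1 + d 1 r.2.2, r.2.1 - d 2 r.2.2, r.2.1 - d 3 r.2.2,
      r.1 + r.2.1])
    (fun r => (r.2.2, r.1 - r.2.1)) ?_ ?_
  · rintro c hc ⟨u, w, x⟩ ⟨u', w', x'⟩ h
    have key := three_distinct_of_five
      (fun i => ![u + d 0 x, u + d 1 x, w - d 2 x, w - d 3 x, u + w] i =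
        ![u' + d 0 x', u' + d 1 x', w' - d 2 x', w' - d 3 x', u' + w'] i) c hc (congrFun h)
    have hinj : ∀ i j, i ≠ j → d i x - d j x = d i x' - d j x' → x = x' :=
      fun i j hij e => hd i j hij e
    have h01 := hinj 0 1 (by decide)
    have h02 := hinj 0 2 (by decide)
    have h03 := hinj 0 3 (by decide)
    have h12 := hinj 1 2 (by decide)
    have h13 := hinj 1 3 (by decide)
    have h23 := hinj 2 3 (by decide)
    simp at key
    simp only [Prod.mk.injEq]
    have hx : x = x' := by grind
    subst hx
    grind
  · rintro k ⟨u, w, x⟩ ⟨u', w', x'⟩ h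
    simp only [Prod.mk.injEq] at h ⊢
    obtain ⟨hk, rfl, hs⟩ := h
    have := hdouble u u'
    have hu : u = u' := by fin_cases k <;> simp at hk <;> grind
    subst hu
    simpa using hs

theorem aoa_1_3_5_odd (n : ℕ) (hn : Odd n) (hn5 : 5 ≤ n) :
    ExistsAOA 1 3 5 n := by
  obtain ⟨k, m, hm3, rfl⟩ := Nat.exists_eq_pow_mul_and_not_dvd (by omega : n ≠ 0) 3 (by norm_num)
  have hmodd : Odd m := (Nat.odd_mul.mp hn).2
  have hm0 : NeZero m := ⟨hmodd.pos.ne'⟩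
  have hm : m.Coprime 6 :=
    Nat.Coprime.mul_right (m := 2) (n := 3) hmodd.coprime_two_right
      ((Nat.Prime.coprime_iff_not_dvd Nat.prime_three).mpr hm3).symm
  match k with
  | 0 =>
    have h := (hasDifferenceMatrix_zmod hm).existsAOA (by simpa using hmodd)
    simpa using h
  | 1 =>
    have hm5 : 5 ≤ m := by
      obtain ⟨l, rfl⟩ := hmodd
      omega
    have h := (hasDifferenceMatrix_three_prod hm hm5).existsAOA (by simpa using hn)
    simpa using h
  | k + 2 =>
    have : Fact (Nat.Prime 3) := ⟨Nat.prime_three⟩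
    have hcard : Nat.card (GaloisField 3 (k + 2)) = 3 ^ (k + 2) := GaloisField.card 3 _ (by omega)
    have hF : HasDifferenceMatrix (GaloisField 3 (k + 2)) := by
      refine hasDifferenceMatrix_of_field ?_
      have := Nat.one_le_pow k 3 (by norm_num)
      rw [hcard, pow_add]
      omega
    have h := (hF.prod (hasDifferenceMatrix_zmod hm)).existsAOA
      (by simpa [Nat.card_prod, hcard] using hn)
    simpa [Nat.card_prod, hcard] using h
end

section
/- Let G be a finite abelian group of order n, and let D = (d_{i,j}) be an (n,4,1)-difference matrix over G. Then the n·n^2 × 5 array whose rows are the vectors (d_{i,1}+u, d_{i,2}+u, d_{i,3}+u+e, d_{i,4}+u+e, e), for 1 ≤ i ≤ n and u, e ∈ G, is a resolvable OA(3,5,n); consequently an AOA(1,3,5,n) exists. -/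
/-- An orthogonal array with strength `t`, `k` columns, row-index type `R` and
symbol type `X`: in any `t` columns every `t`-tuple from `X^t` appears exactly once. -/
def IsOAOn {R X : Type*} (t k : ℕ) (A : R → Fin k → X) : Prop :=
  ∀ c : Fin t → Fin k, Function.Injective c →
    Function.Bijective fun r : R => fun i : Fin t => A r (c i)

/-- The `n·n² × 5` array built from an `(n,4,1)`-difference matrix `D` over `G`,
whose row indexed by `(i, u, e)` is `(d_{i,1}+u, d_{i,2}+u, d_{i,3}+u+e, d_{i,4}+u+e, e)`. -/
def rampArray {n : ℕ} {G : Type*} [AddCommGroup G] (D : Fin n → Fin 4 → G) :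
    Fin n × G × G → Fin 5 → G :=
  fun r => ![D r.1 0 + r.2.1, D r.1 1 + r.2.1, D r.1 2 + r.2.1 + r.2.2,
    D r.1 3 + r.2.1 + r.2.2, r.2.2]

/-- An array over finite types is an orthogonal array of strength `t` as soon as it has the right
number of rows and no two rows agree in `t` columns. -/
theorem isOAOn_of_injective {R X : Type*} [Fintype R] [Fintype X] {t k : ℕ} {A : R → Fin k → X}
    (hcard : Fintype.card R = Fintype.card X ^ t)
    (h : ∀ c : Fin t → Fin k, Function.Injective c →
      Function.Injective fun r : R => fun i : Fin t => A r (c i)) :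
    IsOAOn t k A := by
  classical
  intro c hc
  exact (Fintype.bijective_iff_injective_and_card _).2 ⟨h c hc, by simp [hcard]⟩

/-- If each column of `A` together with `P` is a bijective labelling of the rows, then the fibres
of `P` are orthogonal arrays of strength one. -/
theorem isOAOn_one_fiber {R X Y : Type*} {k : ℕ} {A : R → Fin k → X} {P : R → Y}
    (h : ∀ j, Function.Bijective fun r => (A r j, P r)) (y : Y) :
    IsOAOn 1 k fun r : { r : R // P r = y } => A r.1 := by
  intro c _
  refine ⟨fun r r' hr => Subtype.ext ((h (c 0)).1 ?_), fun x => ?_⟩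
  · exact Prod.ext (congrFun hr 0) (r.2.trans r'.2.symm)
  · obtain ⟨r, hr⟩ := (h (c 0)).2 (x 0, y)
    refine ⟨⟨r, congrArg Prod.snd hr⟩, funext fun i => ?_⟩
    rw [Subsingleton.elim i 0]
    exact congrArg Prod.fst hr

/-- A resolvable orthogonal array of strength `t` yields an augmented orthogonal array. -/
theorem existsAOA_one_of_resolvable {R X Y : Type*} [Fintype R] [Fintype X] [Fintype Y]
    {t k v : ℕ} {A : R → Fin k → X} {P : R → Y} (hR : Fintype.card R = v ^ t)
    (hX : Fintype.card X = v) (hY : Fintype.card Y = v ^ (t - 1)) (hA : IsOAOn t k A)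
    (h : ∀ j, Function.Bijective fun r => (A r j, P r)) : ExistsAOA 1 t k v := by
  let eR := (Fintype.equivFinOfCardEq hR).symm
  let eX := Fintype.equivFinOfCardEq hX
  let eY := Fintype.equivFinOfCardEq hY
  refine ⟨fun r j => eX (A (eR r) j), fun r => eY (P (eR r)), fun c hc => ?_, fun c _ => ?_⟩
  · exact ((Equiv.refl (Fin t)).arrowCongr eX).bijective.comp ((hA c hc).comp eR.bijective)
  · convert (((eX.trans (Equiv.funUnique (Fin 1) (Fin v)).symm).prodCongr eY).bijective.comp
      ((h (c 0)).comp eR.bijective)) using 2 with r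
    refine Prod.ext (funext fun i => ?_) rfl
    rw [Subsingleton.elim i 0]
    rfl

section RampArray

variable {n : ℕ} {G : Type*} [AddCommGroup G] {D : Fin n → Fin 4 → G}

/-- Two rows of the ramp array that agree in three distinct columns are equal. -/
theorem rampArray_row_ext
    (hD : ∀ j l : Fin 4, j ≠ l → Function.Injective fun i : Fin n => D i j - D i l)
    {r r' : Fin n × G × G} {x y z : Fin 5} (hxy : x ≠ y) (hxz : x ≠ z) (hyz : y ≠ z)
    (hx : rampArray D r x = rampArray D r' x) (hy : rampArray D r y = rampArray D r' y)
    (hz : rampArray D r z = rampArray D r' z) : r = r' := by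
  obtain ⟨i, u, e⟩ := r
  obtain ⟨i', u', e'⟩ := r'
  have key : ∀ j l : Fin 4, j ≠ l → D i j - D i l = D i' j - D i' l → i = i' :=
    fun j l hjl h => hD j l hjl h
  have h01 := key 0 1 (by decide)
  have h02 := key 0 2 (by decide)
  have h03 := key 0 3 (by decide)
  have h12 := key 1 2 (by decide)
  have h13 := key 1 3 (by decide)
  have h23 := key 2 3 (by decide)
  let p : Fin 5 → Prop := fun k => rampArray D (i, u, e) k = rampArray D (i', u', e') k
  have hp : ∀ k, p k ↔ rampArray D (i, u, e) k = rampArray D (i', u', e') k := fun k => Iff.rfl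
  have h0 := hp 0
  have h1 := hp 1
  have h2 := hp 2
  have h3 := hp 3
  have h4 := hp 4
  simp only [rampArray, Matrix.cons_val] at h0 h1 h2 h3 h4
  replace hx : p x := hx
  replace hy : p y := hy
  replace hz : p z := hz
  clear_value p
  clear hp key hD
  have p012 : p 0 → p 1 → p 2 → i = i' ∧ u = u' ∧ e = e' := by grind
  have p013 : p 0 → p 1 → p 3 → i = i' ∧ u = u' ∧ e = e' := by grind
  have p014 : p 0 → p 1 → p 4 → i = i' ∧ u = u' ∧ e = e' := by grind
  have p023 : p 0 → p 2 → p 3 → i = i' ∧ u = u' ∧ e = e' := by grind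
  have p024 : p 0 → p 2 → p 4 → i = i' ∧ u = u' ∧ e = e' := by grind
  have p034 : p 0 → p 3 → p 4 → i = i' ∧ u = u' ∧ e = e' := by grind
  have p123 : p 1 → p 2 → p 3 → i = i' ∧ u = u' ∧ e = e' := by grind
  have p124 : p 1 → p 2 → p 4 → i = i' ∧ u = u' ∧ e = e' := by grind
  have p134 : p 1 → p 3 → p 4 → i = i' ∧ u = u' ∧ e = e' := by grind
  have p234 : p 2 → p 3 → p 4 → i = i' ∧ u = u' ∧ e = e' := by grind
  suffices i = i' ∧ u = u' ∧ e = e' by simpa using this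
  clear h0 h1 h2 h3 h4 h01 h02 h03 h12 h13 h23
  generalize (i = i' ∧ u = u' ∧ e = e') = q at *
  fin_cases x <;> fin_cases y <;> first | exact absurd rfl hxy | skip
  all_goals fin_cases z <;> first | exact absurd rfl hxz | exact absurd rfl hyz | skip
  all_goals
    clear hxy hxz hyz
    solve_by_elim

/-- A labelling of the rows of the ramp array by parallel classes. -/
theorem exists_rampArray_resolution [Fintype G] (hG : Fintype.card G = n)
    (hD : ∀ j l : Fin 4, j ≠ l → Function.Bijective fun i : Fin n => D i j - D i l) :
    ∃ P : Fin n × G × G → G × G, ∀ k, Function.Bijective fun r => (rampArray D r k, P r) := by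
  let f := Equiv.ofBijective _ (hD 1 0 (by decide))
  let g := Equiv.ofBijective _ (hD 2 1 (by decide))
  refine ⟨fun r => (f r.1, r.2.1 - f (g.symm r.2.2)), fun k => ?_⟩
  refine (Fintype.bijective_iff_injective_and_card _).2 ⟨?_, by simp [hG]⟩
  rintro ⟨i, u, e⟩ ⟨i', u', e'⟩ h
  obtain ⟨a, rfl⟩ := g.surjective e
  obtain ⟨a', rfl⟩ := g.surjective e'
  simp only [Equiv.symm_apply_apply, Prod.mk.injEq, EmbeddingLike.apply_eq_iff_eq] at h
  obtain ⟨hk, rfl, hu⟩ := h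
  suffices a = a' by
    subst this
    simpa using hu
  have h10 : D a 1 - D a 0 = D a' 1 - D a' 0 → a = a' := fun h => (hD 1 0 (by decide)).1 h
  have h21 : D a 2 - D a 1 = D a' 2 - D a' 1 → a = a' := fun h => (hD 2 1 (by decide)).1 h
  have h20 : D a 2 - D a 0 = D a' 2 - D a' 0 → a = a' := fun h => (hD 2 0 (by decide)).1 h
  simp only [f, g, Equiv.ofBijective_apply] at hk hu
  fin_cases k <;> simp [rampArray] at hk <;> grind

end RampArray

theorem dm_gives_resolvable_oa_3_5 (n : ℕ) (hn : 0 < n) (G : Type*)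
    [AddCommGroup G] [Fintype G] (hG : Fintype.card G = n)
    (D : Fin n → Fin 4 → G)
    (hD : ∀ j ℓ : Fin 4, j ≠ ℓ → Function.Bijective fun i : Fin n => D i j - D i ℓ) :
    IsOAOn 3 5 (rampArray D) ∧
    (∃ P : Fin n × G × G → G × G,
      ∀ y : G × G, IsOAOn 1 5 fun r : { r : Fin n × G × G // P r = y } =>
        rampArray D r.1) ∧
    ExistsAOA 1 3 5 n := by
  have hA : IsOAOn 3 5 (rampArray D) := by
    refine isOAOn_of_injective (by simp [hG]; ring) fun c hc r r' h => ?_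
    exact rampArray_row_ext (fun j l hjl => (hD j l hjl).1) (hc.ne (by decide : (0 : Fin 3) ≠ 1))
      (hc.ne (by decide : (0 : Fin 3) ≠ 2)) (hc.ne (by decide : (1 : Fin 3) ≠ 2))
      (congrFun h 0) (congrFun h 1) (congrFun h 2)
  obtain ⟨P, hP⟩ := exists_rampArray_resolution hG hD
  exact ⟨hA, ⟨P, isOAOn_one_fiber hP⟩,
    existsAOA_one_of_resolvable (by simp [hG]; ring) hG (by simp [hG]; ring) hA hP⟩
end

section
/- There exists an AOA(1,3,6,12) and an AOA(1,3,6,24). -/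
section DifferenceSystem

variable {G I : Type*} [AddCommGroup G]

/-- The six columns of the array developed from `S` and `A`, indexed by `Fin 3 × Bool`. -/
def developedColumn (S : I → G) (A : Fin 3 → I → G) (r : G × G × I) (p : Fin 3 × Bool) : G :=
  ![r.1, r.2.1, -(r.1 + r.2.1 + S r.2.2)] p.1 - if p.2 then A p.1 r.2.2 else 0

/-- Three distinct elements of `Fin 3 × Bool` contain a fibre of the first projection or form
the graph of a function. -/
theorem exists_fibre_or_graph (c : Fin 3 → Fin 3 × Bool) (hc : Function.Injective c) :
    (∃ p, (∃ i, c i = (p, false)) ∧ ∃ i, c i = (p, true)) ∨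
      ∃ T : Finset (Fin 3), ∀ p, ∃ i, c i = (p, decide (p ∈ T)) := by
  by_cases h : Function.Injective fun i => (c i).1
  · right
    choose g hg using Finite.injective_iff_surjective.1 h
    refine ⟨Finset.univ.filter fun p => (c (g p)).2 = true, fun p => ⟨g p, ?_⟩⟩
    ext1
    · exact hg p
    · simp
  · left
    obtain ⟨i, j, hij, hne⟩ := Function.not_injective_iff.1 h
    have h2 : (c i).2 ≠ (c j).2 := fun h2 => hne (hc (Prod.ext hij h2))
    cases hi : (c i).2 <;> cases hj : (c j).2 <;> simp only [hi, hj, ne_eq, not_true] at h2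
    · exact ⟨(c i).1, ⟨i, Prod.ext rfl hi⟩, ⟨j, Prod.ext hij.symm hj⟩⟩
    · exact ⟨(c i).1, ⟨j, Prod.ext hij.symm hj⟩, ⟨i, Prod.ext rfl hi⟩⟩

variable {S : I → G} {A : Fin 3 → I → G}

theorem developedColumn_injective (hA : ∀ p, Function.Injective (A p))
    (hS : ∀ T : Finset (Fin 3), Function.Injective fun x => S x + ∑ p ∈ T, A p x)
    (c : Fin 3 → Fin 3 × Bool) (hc : Function.Injective c) :
    Function.Injective fun r (i : Fin 3) => developedColumn S A r (c i) := by
  rintro ⟨u, w, x⟩ ⟨u', w', x'⟩ h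
  have hcol i := congrFun h i
  simp only at hcol
  obtain rfl : x = x' := by
    rcases exists_fibre_or_graph c hc with ⟨p, ⟨i, hi⟩, j, hj⟩ | ⟨T, hT⟩
    · have h1 := hcol i
      have h2 := hcol j
      simp only [developedColumn, hi, hj, Bool.false_eq_true, if_false, if_true, sub_zero]
        at h1 h2
      rw [h1] at h2
      exact hA p (sub_right_injective h2)
    · have key : ∀ u w x, ∑ p, developedColumn S A (u, w, x) (p, decide (p ∈ T)) =
          -(S x + ∑ p ∈ T, A p x) := by
        intro u w x
        simp only [developedColumn, Finset.sum_sub_distrib, decide_eq_true_eq,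
          Finset.sum_ite_mem, Finset.univ_inter]
        simp only [Fin.sum_univ_three, Matrix.cons_val]
        abel
      refine hS T (neg_injective ?_)
      simp only [← key u w x, ← key u' w' x']
      refine Finset.sum_congr rfl fun p _ => ?_
      obtain ⟨i, hi⟩ := hT p
      exact hi ▸ hcol i
  have hbase i : ![u, w, -(u + w + S x)] (c i).1 = ![u', w', -(u' + w' + S x)] (c i).1 :=
    sub_left_injective (hcol i)
  obtain ⟨i, j, hij⟩ : ∃ i j, (c i).1 ≠ (c j).1 := by
    by_contra! hall
    have : Function.Injective fun i => (c i).2 := fun i j hij => hc (Prod.ext (hall i j) hij)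
    simpa using Fintype.card_le_of_injective _ this
  have hi := hbase i
  have hj := hbase j
  generalize (c i).1 = p at *
  generalize (c j).1 = q at *
  fin_cases p <;> fin_cases q <;> simp_all

theorem developedColumn_label_injective {φ : G → G} (hφ : Function.Injective φ)
    (hφ' : Function.Injective fun u => u + φ u) (p : Fin 3 × Bool) :
    Function.Injective fun r : G × G × I =>
      (developedColumn S A r p, r.2.1 - φ r.1, r.2.2) := by
  rintro ⟨u, w, x⟩ ⟨u', w', x'⟩ h
  simp only [Prod.mk.injEq] at h
  obtain ⟨h1, h2, rfl⟩ := h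
  have hbase : ![u, w, -(u + w + S x)] p.1 = ![u', w', -(u' + w' + S x)] p.1 :=
    sub_left_injective h1
  obtain rfl : u = u' := by
    generalize p.1 = q at hbase
    fin_cases q
    · exact hbase
    · obtain rfl : w = w' := hbase
      exact hφ (sub_right_injective h2)
    · have h3 : u + w = u' + w' := add_left_injective (S x) (neg_injective hbase)
      refine hφ' ?_
      calc u + φ u = u + w - (w - φ u) := by abel
        _ = u' + w' - (w' - φ u') := by rw [h3, h2]
        _ = u' + φ u' := by abel
  simpa using h2

/-- If `A p` and all the sums `S + ∑ p ∈ T, A p` are injective, and `φ` and `id + φ` are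
injective, then developing over `G` gives an AOA(1,3,6,|G|). -/
theorem existsAOA_of_differenceSystem [Fintype G] [Fintype I] {v : ℕ}
    (hG : Fintype.card G = v) (hI : Fintype.card I = v) (hA : ∀ p, Function.Injective (A p))
    (hS : ∀ T : Finset (Fin 3), Function.Injective fun x => S x + ∑ p ∈ T, A p x)
    {φ : G → G} (hφ : Function.Injective φ) (hφ' : Function.Injective fun u => u + φ u) :
    ExistsAOA 1 3 6 v := by
  let eR : Fin (v ^ 3) ≃ G × G × I := Fintype.equivOfCardEq (by simp [hG, hI]; ring)
  let eL : G × I ≃ Fin (v ^ (3 - 1)) := Fintype.equivOfCardEq (by simp [hG, hI]; ring)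
  let eG : G ≃ Fin v := Fintype.equivOfCardEq (by simp [hG])
  let eC : Fin 6 ≃ Fin 3 × Bool := Fintype.equivOfCardEq (by simp)
  refine ⟨fun r j => eG (developedColumn S A (eR r) (eC j)),
    fun r => eL ((eR r).2.1 - φ (eR r).1, (eR r).2.2), fun c hc => ?_, fun c _ => ?_⟩
  · refine (Fintype.bijective_iff_injective_and_card _).2 ⟨fun r r' h => eR.injective ?_, ?_⟩
    · exact developedColumn_injective hA hS (eC ∘ c) (eC.injective.comp hc)
        (funext fun i => eG.injective (congrFun h i))
    · simp
  · refine (Fintype.bijective_iff_injective_and_card _).2 ⟨fun r r' h => eR.injective ?_, ?_⟩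
    · simp only [Prod.mk.injEq] at h
      exact developedColumn_label_injective hφ hφ' (eC (c 0))
        (Prod.ext (eG.injective (congrFun h.1 0)) (eL.injective h.2))
    · simp; ring

end DifferenceSystem

/-- The base function of a difference system over `ZMod 2 × ZMod 2 × ZMod 3`. -/
def base12 : Fin 12 → ZMod 2 × ZMod 2 × ZMod 3 :=
  ![(0, 0, 0), (1, 1, 2), (0, 1, 2), (1, 0, 1), (1, 0, 2), (0, 1, 1),
    (1, 0, 0), (0, 1, 0), (0, 0, 2), (1, 1, 1), (1, 1, 0), (0, 0, 1)]

/-- The three shift functions of a difference system over `ZMod 2 × ZMod 2 × ZMod 3`. -/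
def shift12 : Fin 3 → Fin 12 → ZMod 2 × ZMod 2 × ZMod 3 :=
  ![![(0, 0, 0), (1, 0, 0), (0, 1, 0), (1, 1, 0), (0, 0, 1), (1, 0, 1),
    (0, 1, 1), (1, 1, 1), (0, 0, 2), (1, 0, 2), (0, 1, 2), (1, 1, 2)],
  ![(0, 0, 0), (1, 0, 0), (0, 1, 0), (1, 1, 0), (0, 1, 1), (1, 1, 2),
    (0, 0, 2), (1, 0, 1), (1, 0, 2), (0, 0, 1), (1, 1, 1), (0, 1, 2)],
  ![(0, 0, 0), (1, 0, 2), (0, 1, 0), (1, 1, 2), (0, 1, 2), (1, 1, 0),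
    (0, 0, 2), (1, 0, 0), (1, 0, 1), (0, 0, 1), (1, 1, 1), (0, 1, 1)]]

/-- The base function of a difference system over `ZMod 2 × ZMod 2 × ZMod 2 × ZMod 3`. -/
def base24 : Fin 24 → ZMod 2 × ZMod 2 × ZMod 2 × ZMod 3 :=
  ![(0, 0, 0, 0), (0, 0, 1, 0), (1, 0, 0, 1), (1, 0, 1, 1),
    (0, 0, 0, 1), (0, 0, 1, 1), (1, 0, 1, 0), (1, 0, 0, 0),
    (1, 1, 1, 2), (1, 1, 0, 2), (1, 1, 1, 1), (1, 1, 0, 1),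
    (0, 1, 1, 1), (0, 1, 0, 1), (0, 1, 0, 2), (0, 1, 1, 2),
    (0, 1, 1, 0), (0, 1, 0, 0), (1, 1, 0, 0), (1, 1, 1, 0),
    (1, 0, 0, 2), (1, 0, 1, 2), (0, 0, 1, 2), (0, 0, 0, 2)]

/-- The three shift functions of a difference system over `ZMod 2 × ZMod 2 × ZMod 2 × ZMod 3`. -/
def shift24 : Fin 3 → Fin 24 → ZMod 2 × ZMod 2 × ZMod 2 × ZMod 3 :=
  ![![(0, 0, 0, 0), (1, 0, 0, 0), (0, 1, 0, 0), (1, 1, 0, 0),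
    (0, 0, 1, 0), (1, 0, 1, 0), (0, 1, 1, 0), (1, 1, 1, 0),
    (0, 0, 0, 1), (1, 0, 0, 1), (0, 1, 0, 1), (1, 1, 0, 1),
    (0, 0, 1, 1), (1, 0, 1, 1), (0, 1, 1, 1), (1, 1, 1, 1),
    (0, 0, 0, 2), (1, 0, 0, 2), (0, 1, 0, 2), (1, 1, 0, 2),
    (0, 0, 1, 2), (1, 0, 1, 2), (0, 1, 1, 2), (1, 1, 1, 2)],
  ![(0, 0, 0, 0), (1, 0, 0, 0), (0, 0, 0, 2), (1, 0, 0, 2),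
    (0, 0, 0, 1), (1, 0, 0, 1), (0, 1, 0, 1), (1, 1, 0, 1),
    (0, 0, 1, 1), (1, 0, 1, 1), (0, 1, 1, 0), (1, 1, 1, 0),
    (1, 1, 1, 1), (0, 1, 1, 1), (0, 1, 0, 2), (1, 1, 0, 2),
    (0, 0, 1, 2), (1, 0, 1, 2), (0, 0, 1, 0), (1, 0, 1, 0),
    (1, 1, 1, 2), (0, 1, 1, 2), (0, 1, 0, 0), (1, 1, 0, 0)],
  ![(0, 0, 0, 0), (1, 0, 0, 0), (1, 0, 1, 1), (0, 0, 1, 1),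
    (1, 0, 0, 2), (0, 0, 0, 2), (0, 1, 1, 1), (1, 1, 1, 1),
    (0, 0, 0, 1), (1, 0, 0, 1), (0, 1, 0, 1), (1, 1, 0, 1),
    (1, 1, 1, 0), (0, 1, 1, 0), (1, 1, 1, 2), (0, 1, 1, 2),
    (0, 0, 1, 2), (1, 0, 1, 2), (1, 0, 1, 0), (0, 0, 1, 0),
    (1, 1, 0, 2), (0, 1, 0, 2), (0, 1, 0, 0), (1, 1, 0, 0)]]

theorem aoa_1_3_6_12_and_24 : ExistsAOA 1 3 6 12 ∧ ExistsAOA 1 3 6 24 := by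
  constructor
  · exact existsAOA_of_differenceSystem (S := base12) (A := shift12)
      (φ := fun g => (g.2.1, g.1 + g.2.1, g.2.2)) (by simp [ZMod.card]) (by simp)
      (by decide +kernel) (by decide +kernel) (by decide +kernel) (by decide +kernel)
  · exact existsAOA_of_differenceSystem (S := base24) (A := shift24)
      (φ := fun g => (g.2.2.1, g.1 + g.2.2.1, g.2.1, g.2.2.2)) (by simp [ZMod.card]) (by simp)
      (by decide +kernel) (by decide +kernel) (by decide +kernel) (by decide +kernel)
end

section
/- Let v be a positive integer satisfying gcd(v,4) ≠ 2 and gcd(v,18) ≠ 3. Then there exists an AOA(1,3,6,v). -/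
/-- Functions on an abelian group `G` whose listed combinations are all injective. The rows
`(x, x + t, y, y + q t, x + y + r t, x + y + s t)` then form an orthogonal array of strength three,
and `(x, y, t) ↦ (y - m x, t)` is an augmenting column. -/
structure IsSeed {G : Type} [AddCommGroup G] (m : G →+ G) (q r s : G → G) : Prop where
  m_inj : Function.Injective m
  add_m_inj : Function.Injective fun x => x + m x
  q_inj : Function.Injective q
  r_inj : Function.Injective r
  s_inj : Function.Injective s
  sub_r_inj : Function.Injective fun t => t - r t
  sub_s_inj : Function.Injective fun t => t - s t
  q_sub_r_inj : Function.Injective fun t => q t - r t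
  q_sub_s_inj : Function.Injective fun t => q t - s t
  r_sub_s_inj : Function.Injective fun t => r t - s t
  add_q_sub_r_inj : Function.Injective fun t => t + q t - r t
  add_q_sub_s_inj : Function.Injective fun t => t + q t - s t

/-- Some abelian group of order `v` carries a seed. -/
def HasSeed (v : ℕ) : Prop :=
  ∃ (G : Type) (_ : AddCommGroup G) (_ : Fintype G) (m : G →+ G) (q r s : G → G),
    Fintype.card G = v ∧ IsSeed m q r s

/-- The six columns of the array determined by `q`, `r` and `s`. -/
def seedColumn {G : Type} [AddCommGroup G] (q r s : G → G) (a : G × G × G) : Fin 6 → G :=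
  ![a.1, a.1 + a.2.2, a.2.1, a.2.1 + q a.2.2, a.1 + a.2.1 + r a.2.2, a.1 + a.2.1 + s a.2.2]

section Columns

variable {G : Type} [AddCommGroup G] {m : G →+ G} {q r s : G → G}

theorem IsSeed.eq_of_three_columns (h : IsSeed m q r s) {a b : G × G × G} {c : Fin 3 → Fin 6}
    (hc : Function.Injective c)
    (hab : ∀ i, seedColumn q r s a (c i) = seedColumn q r s b (c i)) : a = b := by
  classical
  obtain ⟨x, y, t⟩ := a
  obtain ⟨x', y', t'⟩ := b
  have combinatorial : ∀ S : Finset (Fin 6), 3 ≤ S.card →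
      (0 ∈ S ∧ 1 ∈ S ∨ 2 ∈ S ∧ 3 ∈ S ∨ 4 ∈ S ∧ 5 ∈ S ∨
        (0 ∈ S ∨ 1 ∈ S) ∧ (2 ∈ S ∨ 3 ∈ S) ∧ (4 ∈ S ∨ 5 ∈ S)) ∧
      ((0 ∈ S ∨ 1 ∈ S) ∧ (2 ∈ S ∨ 3 ∈ S) ∨ (0 ∈ S ∨ 1 ∈ S) ∧ (4 ∈ S ∨ 5 ∈ S) ∨
        (2 ∈ S ∨ 3 ∈ S) ∧ (4 ∈ S ∨ 5 ∈ S)) := by decide +kernel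
  let S : Finset (Fin 6) :=
    {i | seedColumn q r s (x, y, t) i = seedColumn q r s (x', y', t') i}
  have hcard : 3 ≤ S.card := by
    have : Finset.univ.map ⟨c, hc⟩ ⊆ S := by
      intro i hi
      obtain ⟨j, -, rfl⟩ := Finset.mem_map.1 hi
      simpa [S] using hab j
    simpa using Finset.card_le_card this
  have mem (i) : i ∈ S ↔ seedColumn q r s (x, y, t) i = seedColumn q r s (x', y', t') i := by
    simp [S]
  have h0 : 0 ∈ S ↔ x = x' := mem 0
  have h1 : 1 ∈ S ↔ x + t = x' + t' := mem 1
  have h2 : 2 ∈ S ↔ y = y' := mem 2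
  have h3 : 3 ∈ S ↔ y + q t = y' + q t' := mem 3
  have h4 : 4 ∈ S ↔ x + y + r t = x' + y' + r t' := mem 4
  have h5 : 5 ∈ S ↔ x + y + s t = x' + y' + s t' := mem 5
  obtain ⟨hA, hB⟩ := combinatorial S hcard
  simp only [h0, h1, h2, h3, h4, h5] at hA hB
  have ht : t = t' := by
    rcases hA with ⟨e, f⟩ | ⟨e, f⟩ | ⟨e, f⟩ | ⟨e | e, f | f, g | g⟩
    · grind
    · exact h.q_inj (by grind)
    · exact h.r_sub_s_inj (by grind)
    · exact h.r_inj (by grind)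
    · exact h.s_inj (by grind)
    · exact h.q_sub_r_inj (by grind)
    · exact h.q_sub_s_inj (by grind)
    · exact h.sub_r_inj (by grind)
    · exact h.sub_s_inj (by grind)
    · exact h.add_q_sub_r_inj (by grind)
    · exact h.add_q_sub_s_inj (by grind)
  subst ht
  simp only [add_left_inj, or_self] at hB
  rcases hB with ⟨rfl, rfl⟩ | ⟨rfl, hB⟩ | ⟨rfl, hB⟩
  · rfl
  · simpa using hB
  · simpa using hB

theorem IsSeed.eq_of_column_of_augment (h : IsSeed m q r s) {a b : G × G × G} {i : Fin 6}
    (hi : seedColumn q r s a i = seedColumn q r s b i) (ht : a.2.2 = b.2.2)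
    (hm : a.2.1 - m a.1 = b.2.1 - m b.1) : a = b := by
  obtain ⟨x, y, t⟩ := a
  obtain ⟨x', y', t'⟩ := b
  obtain rfl : t = t' := ht
  replace hm : y - m x = y' - m x' := hm
  have hi' : x = x' ∨ y = y' ∨ x + y = x' + y' := by
    fin_cases i <;> simp_all [seedColumn]
  have hx : x = x' := by
    rcases hi' with hi' | hi' | hi'
    · exact hi'
    · exact h.m_inj (by grind)
    · exact h.add_m_inj (by grind)
  subst hx
  simpa using hm

end Columns

theorem HasSeed.existsAOA {v : ℕ} (h : HasSeed v) : ExistsAOA 1 3 6 v := by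
  obtain ⟨G, _, _, m, q, r, s, rfl, h⟩ := h
  let e : Fin (Fintype.card G ^ 3) ≃ G × G × G :=
    Fintype.equivOfCardEq (by simp [pow_succ, mul_assoc])
  let φ : G ≃ Fin (Fintype.card G) := Fintype.equivFin G
  let ψ : G × G ≃ Fin (Fintype.card G ^ (3 - 1)) := Fintype.equivOfCardEq (by simp [sq])
  refine ⟨fun i j => φ (seedColumn q r s (e i) j),
    fun i => ψ ((e i).2.1 - m (e i).1, (e i).2.2), fun c hc => ?_, fun c _ => ?_⟩
  · refine (Fintype.bijective_iff_injective_and_card _).2 ⟨fun i j hij => ?_, by simp⟩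
    exact e.injective <| h.eq_of_three_columns hc fun k => φ.injective (congrFun hij k)
  · refine (Fintype.bijective_iff_injective_and_card _).2
      ⟨fun i j hij => ?_, by simp [pow_succ, mul_assoc]⟩
    obtain ⟨hcol, haug⟩ := Prod.mk.inj hij
    obtain ⟨hm, ht⟩ := Prod.mk.inj (ψ.injective haug)
    exact e.injective <| h.eq_of_column_of_augment (φ.injective (congrFun hcol 0)) ht hm

theorem HasSeed.one : HasSeed 1 :=
  ⟨Unit, inferInstance, inferInstance, 0, id, id, id, rfl, by
    constructor <;> exact Function.injective_of_subsingleton _⟩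

theorem HasSeed.mul {v w : ℕ} (hv : HasSeed v) (hw : HasSeed w) : HasSeed (v * w) := by
  obtain ⟨G, _, _, m, q, r, s, rfl, h⟩ := hv
  obtain ⟨H, _, _, m', q', r', s', rfl, h'⟩ := hw
  exact ⟨G × H, inferInstance, inferInstance, m.prodMap m', Prod.map q q', Prod.map r r',
    Prod.map s s', Fintype.card_prod G H,
    h.m_inj.prodMap h'.m_inj, h.add_m_inj.prodMap h'.add_m_inj, h.q_inj.prodMap h'.q_inj,
    h.r_inj.prodMap h'.r_inj, h.s_inj.prodMap h'.s_inj, h.sub_r_inj.prodMap h'.sub_r_inj,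
    h.sub_s_inj.prodMap h'.sub_s_inj, h.q_sub_r_inj.prodMap h'.q_sub_r_inj,
    h.q_sub_s_inj.prodMap h'.q_sub_s_inj, h.r_sub_s_inj.prodMap h'.r_sub_s_inj,
    h.add_q_sub_r_inj.prodMap h'.add_q_sub_r_inj, h.add_q_sub_s_inj.prodMap h'.add_q_sub_s_inj⟩

theorem HasSeed.card_field (F : Type) [Field F] [Fintype F] (hF : 4 ≤ Fintype.card F) :
    HasSeed (Fintype.card F) := by
  classical
  obtain ⟨c, hc⟩ : ∃ c : F, c ∉ ({0, 1, 2} : Finset F) := by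
    by_contra! h
    have := Finset.card_le_three (a := (0 : F)) (b := 1) (c := 2)
    rw [Finset.eq_univ_iff_forall.2 h, Finset.card_univ] at this
    omega
  obtain ⟨d, hd⟩ : ∃ d : F, d ∉ ({0, 1, 2, c} : Finset F) := by
    by_contra! h
    have hle := Finset.card_le_four (a := (0 : F)) (b := 1) (c := 2) (d := c)
    rw [Finset.eq_univ_iff_forall.2 h, Finset.card_univ] at hle
    have h4 : ((4 : ℕ) : F) = 0 := by
      rw [← le_antisymm hle hF]
      exact Nat.cast_card_eq_zero F
    have h2 : (2 : F) = 0 := by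
      have : (2 : F) * 2 = 0 := by
        rw [← h4]
        norm_num
      simpa using this
    have hle' := Finset.card_le_three (a := (1 : F)) (b := 0) (c := c)
    rw [h2, Finset.insert_comm, Finset.insert_eq_of_mem (a := (0 : F)) (by simp)] at h
    rw [Finset.eq_univ_iff_forall.2 h, Finset.card_univ] at hle'
    omega
  simp only [Finset.mem_insert, Finset.mem_singleton, not_or] at hc hd
  have inj {f : F → F} {a : F} (ha : a ≠ 0) (hf : ∀ t, f t = a * t) : Function.Injective f := by
    rw [funext hf]
    exact mul_right_injective₀ ha
  have hm (t : F) : AddMonoidHom.mulLeft (-c) t = -c * t := rfl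
  refine ⟨F, inferInstance, inferInstance, AddMonoidHom.mulLeft (-c), id, (c * ·), (d * ·), rfl,
    inj (a := -c) ?_ ?_, inj (a := 1 - c) ?_ ?_, Function.injective_id, inj hc.1 ?_, inj hd.1 ?_,
    inj (a := 1 - c) ?_ ?_, inj (a := 1 - d) ?_ ?_, inj (a := 1 - c) ?_ ?_,
    inj (a := 1 - d) ?_ ?_, inj (a := c - d) ?_ ?_, inj (a := 2 - c) ?_ ?_,
    inj (a := 2 - d) ?_ ?_⟩ <;> grind

theorem HasSeed.prime_pow {p k : ℕ} (hp : p.Prime) (h : 4 ≤ p ^ k) : HasSeed (p ^ k) := by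
  have : Fact p.Prime := ⟨hp⟩
  have hk : k ≠ 0 := by
    rintro rfl
    simp at h
  have : Fintype (GaloisField p k) := Fintype.ofFinite _
  have hcard : Fintype.card (GaloisField p k) = p ^ k := by
    rw [← Nat.card_eq_fintype_card, GaloisField.card p k hk]
  rw [← hcard] at h ⊢
  exact HasSeed.card_field _ h

/-- The function `q` of the seed on `ZMod 2 × ZMod 2 × ZMod 3`. -/
def twelveQ (t : ZMod 2 × ZMod 2 × ZMod 3) : ZMod 2 × ZMod 2 × ZMod 3 :=
  (show Fin 2 → Fin 2 → Fin 3 → ZMod 2 × ZMod 2 × ZMod 3 from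
    ![![![(0, 0, 0), (1, 0, 1), (0, 1, 2)], ![(0, 1, 0), (1, 1, 1), (0, 0, 2)]], ![![(1, 0, 2),
    (0, 0, 1), (1, 1, 0)], ![(1, 1, 2), (0, 1, 1), (1, 0, 0)]]])
    t.1 t.2.1 t.2.2

/-- The function `r` of the seed on `ZMod 2 × ZMod 2 × ZMod 3`. -/
def twelveR (t : ZMod 2 × ZMod 2 × ZMod 3) : ZMod 2 × ZMod 2 × ZMod 3 :=
  (show Fin 2 → Fin 2 → Fin 3 → ZMod 2 × ZMod 2 × ZMod 3 from
    ![![![(0, 0, 0), (0, 0, 2), (1, 0, 0)], ![(0, 0, 1), (1, 0, 1), (1, 1, 2)]], ![![(0, 1, 1),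
    (0, 1, 0), (1, 1, 1)], ![(0, 1, 2), (1, 1, 0), (1, 0, 2)]]])
    t.1 t.2.1 t.2.2

/-- The function `s` of the seed on `ZMod 2 × ZMod 2 × ZMod 3`. -/
def twelveS (t : ZMod 2 × ZMod 2 × ZMod 3) : ZMod 2 × ZMod 2 × ZMod 3 :=
  (show Fin 2 → Fin 2 → Fin 3 → ZMod 2 × ZMod 2 × ZMod 3 from
    ![![![(0, 0, 0), (1, 0, 0), (1, 1, 2)], ![(0, 1, 1), (0, 1, 0), (1, 1, 0)]], ![![(1, 1, 1),
    (0, 1, 2), (0, 0, 2)], ![(1, 0, 2), (1, 0, 1), (0, 0, 1)]]])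
    t.1 t.2.1 t.2.2


/-- The function `q` of the seed on `ZMod 2 × ZMod 2 × ZMod 2 × ZMod 3`. -/
def twentyFourQ (t : ZMod 2 × ZMod 2 × ZMod 2 × ZMod 3) : ZMod 2 × ZMod 2 × ZMod 2 × ZMod 3 :=
  (show Fin 2 → Fin 2 → Fin 2 → Fin 3 → ZMod 2 × ZMod 2 × ZMod 2 × ZMod 3 from
    ![![![![(0, 0, 0, 0), (1, 1, 1, 1), (1, 1, 1, 2)], ![(1, 0, 1, 0), (0, 0, 1, 2), (1, 0, 1,
    1)]], ![![(0, 1, 0, 0), (0, 0, 0, 1), (0, 0, 0, 2)], ![(0, 1, 0, 2), (1, 1, 0, 1), (1, 1, 1,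
    0)]]], ![![![(1, 0, 0, 0), (0, 1, 1, 1), (0, 1, 1, 2)], ![(0, 0, 1, 0), (1, 0, 1, 2), (0, 0,
    1, 1)]], ![![(1, 1, 0, 0), (1, 0, 0, 1), (1, 0, 0, 2)], ![(1, 1, 0, 2), (0, 1, 0, 1), (0, 1,
    1, 0)]]]])
    t.1 t.2.1 t.2.2.1 t.2.2.2

/-- The function `r` of the seed on `ZMod 2 × ZMod 2 × ZMod 2 × ZMod 3`. -/
def twentyFourR (t : ZMod 2 × ZMod 2 × ZMod 2 × ZMod 3) : ZMod 2 × ZMod 2 × ZMod 2 × ZMod 3 :=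
  (show Fin 2 → Fin 2 → Fin 2 → Fin 3 → ZMod 2 × ZMod 2 × ZMod 2 × ZMod 3 from
    ![![![![(0, 0, 0, 0), (1, 0, 0, 0), (1, 0, 1, 2)], ![(0, 0, 1, 1), (0, 0, 0, 2), (0, 1, 1,
    0)]], ![![(0, 1, 1, 2), (1, 0, 1, 1), (1, 0, 0, 1)], ![(1, 1, 1, 0), (1, 1, 0, 2), (0, 0, 0,
    1)]]], ![![![(0, 1, 0, 0), (1, 1, 0, 0), (1, 1, 1, 2)], ![(0, 1, 1, 1), (0, 1, 0, 2), (0, 0,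
    1, 0)]], ![![(0, 0, 1, 2), (1, 1, 1, 1), (1, 1, 0, 1)], ![(1, 0, 1, 0), (1, 0, 0, 2), (0, 1,
    0, 1)]]]])
    t.1 t.2.1 t.2.2.1 t.2.2.2

/-- The function `s` of the seed on `ZMod 2 × ZMod 2 × ZMod 2 × ZMod 3`. -/
def twentyFourS (t : ZMod 2 × ZMod 2 × ZMod 2 × ZMod 3) : ZMod 2 × ZMod 2 × ZMod 2 × ZMod 3 :=
  (show Fin 2 → Fin 2 → Fin 2 → Fin 3 → ZMod 2 × ZMod 2 × ZMod 2 × ZMod 3 from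
    ![![![![(0, 0, 0, 0), (0, 0, 1, 1), (1, 0, 0, 2)], ![(1, 1, 0, 2), (1, 0, 0, 1), (1, 0, 1,
    0)]], ![![(0, 0, 0, 1), (1, 1, 1, 2), (0, 0, 1, 0)], ![(1, 0, 1, 2), (0, 1, 0, 0), (0, 1, 1,
    1)]]], ![![![(1, 1, 0, 0), (1, 1, 1, 1), (0, 1, 0, 2)], ![(0, 0, 0, 2), (0, 1, 0, 1), (0, 1,
    1, 0)]], ![![(1, 1, 0, 1), (0, 0, 1, 2), (1, 1, 1, 0)], ![(0, 1, 1, 2), (1, 0, 0, 0), (1, 0,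
    1, 1)]]]])
    t.1 t.2.1 t.2.2.1 t.2.2.2


theorem HasSeed.twelve : HasSeed 12 := by
  refine ⟨ZMod 2 × ZMod 2 × ZMod 3, inferInstance, inferInstance,
    AddMonoidHom.mk' (fun t => (t.2.1, t.1 + t.2.1, t.2.2)) (by decide +kernel),
    twelveQ, twelveR, twelveS, rfl, ?_⟩
  constructor <;> decide +kernel

theorem HasSeed.twentyFour : HasSeed 24 := by
  refine ⟨ZMod 2 × ZMod 2 × ZMod 2 × ZMod 3, inferInstance, inferInstance,
    AddMonoidHom.mk' (fun t => (t.2.2.1, t.1 + t.2.2.1, t.2.1, t.2.2.2)) (by decide +kernel),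
    twentyFourQ, twentyFourR, twentyFourS, rfl, ?_⟩
  constructor <;> decide +kernel

theorem HasSeed.three_mul_two_pow {a : ℕ} (ha : 2 ≤ a) : HasSeed (3 * 2 ^ a) := by
  obtain rfl | rfl | ⟨b, rfl⟩ : a = 2 ∨ a = 3 ∨ ∃ b, a = b + 4 := by
    by_cases h : 4 ≤ a
    · exact .inr (.inr ⟨a - 4, by omega⟩)
    · omega
  · exact HasSeed.twelve
  · exact HasSeed.twentyFour
  · have hpow : 4 ≤ 2 ^ (b + 2) := by
      simpa using Nat.pow_le_pow_right (n := 2) two_pos (Nat.le_add_left 2 b)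
    have := HasSeed.twelve.mul (HasSeed.prime_pow Nat.prime_two hpow)
    convert this using 1
    ring

theorem HasSeed.of_prime_powers {v : ℕ} (hv : v ≠ 0)
    (h : ∀ p, p.Prime → p ∣ v → 4 ≤ p ^ v.factorization p) : HasSeed v := by
  rw [← Nat.prod_factorization_pow_eq_self hv]
  refine Finset.prod_induction _ HasSeed (fun _ _ => HasSeed.mul) HasSeed.one fun p hp => ?_
  have hp' := Nat.prime_of_mem_primeFactors hp
  exact HasSeed.prime_pow hp' (h p hp' (Nat.dvd_of_mem_primeFactors hp))

theorem HasSeed.of_sq_dvd {v : ℕ} (hv : v ≠ 0) (h2 : 2 ∣ v → 2 ^ 2 ∣ v) (h3 : 3 ∣ v → 3 ^ 2 ∣ v) :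
    HasSeed v := by
  have four_le {p : ℕ} (hp : p.Prime) (hdvd : p ^ 2 ∣ v) : 4 ≤ p ^ v.factorization p := by
    calc 4 = 2 ^ 2 := rfl
      _ ≤ p ^ 2 := Nat.pow_le_pow_left hp.two_le 2
      _ ≤ p ^ v.factorization p :=
        Nat.pow_le_pow_right hp.pos ((hp.pow_dvd_iff_le_factorization hv).1 hdvd)
  refine HasSeed.of_prime_powers hv fun p hp hpv => ?_
  obtain rfl | rfl | h : p = 2 ∨ p = 3 ∨ 4 ≤ p := by
    have := hp.two_le
    omega
  · exact four_le hp (h2 hpv)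
  · exact four_le hp (h3 hpv)
  · exact h.trans (Nat.le_self_pow (hp.factorization_pos_of_dvd hv hpv).ne' p)

theorem aoa_1_3_6 (v : ℕ) (hv : 0 < v) (h4 : Nat.gcd v 4 ≠ 2) (h18 : Nat.gcd v 18 ≠ 3) :
    ExistsAOA 1 3 6 v := by
  apply HasSeed.existsAOA
  have h2 : 2 ∣ v → 4 ∣ v := fun h => by
    by_contra h'
    apply h4
    rw [Nat.gcd_comm, Nat.gcd_rec, (by omega : v % 4 = 2)]
    rfl
  by_cases h3 : 3 ∣ v → 9 ∣ v
  · exact HasSeed.of_sq_dvd hv.ne' h2 h3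
  obtain ⟨h3v, h9v⟩ := Classical.not_imp.1 h3
  have heven : 2 ∣ v := by
    by_contra h
    apply h18
    rw [Nat.gcd_comm, Nat.gcd_rec]
    obtain h | h : v % 18 = 3 ∨ v % 18 = 15 := by omega
    all_goals
      rw [h]
      rfl
  obtain ⟨u, rfl⟩ := h3v
  obtain ⟨a, w, hw, rfl⟩ := Nat.exists_eq_two_pow_mul_odd (n := u) (by omega)
  have hodd := Nat.odd_iff.1 hw
  have ha : 2 ≤ a := by
    by_contra! ha
    interval_cases a <;> omega
  rw [← mul_assoc]
  refine (HasSeed.three_mul_two_pow ha).mul (HasSeed.of_sq_dvd (by omega) (by omega) fun h => ?_)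
  exact absurd (mul_dvd_mul_left 3 (h.mul_left (2 ^ a))) h9v
end

section
/- There exists an AOA(1,3,6,15) and an AOA(1,3,6,21). -/
/-- Arrays indexed by arbitrary finite types of the right sizes can be relabelled
to give an augmented orthogonal array. -/
theorem ExistsAOA.of_injective {s t k v : ℕ} {ρ X Y : Type*} [Fintype ρ] [Fintype X] [Fintype Y]
    (hst : s ≤ t) (hρ : Fintype.card ρ = v ^ t) (hX : Fintype.card X = v)
    (hY : Fintype.card Y = v ^ (t - s)) (A : ρ → Fin k → X) (L : ρ → Y)
    (hA : ∀ c : Fin t → Fin k, Function.Injective c →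
      Function.Injective fun r : ρ => fun i : Fin t => A r (c i))
    (hL : ∀ c : Fin s → Fin k, Function.Injective c →
      Function.Injective fun r : ρ => ((fun i : Fin s => A r (c i)), L r)) :
    ExistsAOA s t k v := by
  let eρ := (Fintype.equivFinOfCardEq hρ).symm
  let eX := Fintype.equivFinOfCardEq hX
  let eY := Fintype.equivFinOfCardEq hY
  refine ⟨fun r i => eX (A (eρ r) i), fun r => eY (L (eρ r)), fun c hc => ?_, fun c hc => ?_⟩
  · rw [Fintype.bijective_iff_injective_and_card]
    refine ⟨fun r r' h => eρ.injective (hA c hc (funext fun i => ?_)), by simp⟩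
    exact eX.injective (congrFun h i)
  · rw [Fintype.bijective_iff_injective_and_card]
    refine ⟨fun r r' h => eρ.injective (hL c hc (Prod.ext (funext fun i => ?_) ?_)), ?_⟩
    · exact eX.injective (congrFun (congrArg Prod.fst h) i)
    · exact eY.injective (congrArg Prod.snd h)
    · simp [← pow_add, Nat.add_sub_cancel' hst]

/-- The determinant of the `3 × 3` matrix formed by columns `i`, `j`, `k` of the matrix with
rows `1`, `z`, `r`. -/
def threeColDet {K : Type*} [CommRing K] (z r : Fin 6 → K) (i j k : Fin 6) : K :=
  (z j - z k) * r i + (z k - z i) * r j + (z i - z j) * r k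

/-- The rows `α + β z + R γ` form an AOA(1,3,6,v) when every three-column determinant separates
the base rows `R γ` and no nonzero scalar kills all differences of three entries of `z`. -/
theorem existsAOA_of_threeColDet {v : ℕ} [NeZero v] (z : Fin 6 → ZMod v)
    (R : Fin v → Fin 6 → ZMod v)
    (hz : ∀ i j k : Fin 6, i ≠ j → i ≠ k → j ≠ k →
      ∀ d : ZMod v, d * (z i - z j) = 0 → d * (z i - z k) = 0 → d = 0)
    (hR : ∀ i j k : Fin 6, i ≠ j → i ≠ k → j ≠ k →
      Function.Injective fun γ => threeColDet z (R γ) i j k) :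
    ExistsAOA 1 3 6 v := by
  refine ExistsAOA.of_injective (ρ := ZMod v × ZMod v × Fin v) (X := ZMod v)
    (Y := ZMod v × Fin v) (by norm_num) (by simp [ZMod.card]; ring) (ZMod.card v)
    (by simp [ZMod.card]; ring) (fun r i => r.1 + r.2.1 * z i + R r.2.2 i) (fun r => r.2) ?_ ?_
  · rintro c hc ⟨α, β, γ⟩ ⟨α', β', γ'⟩ h
    have h0 := congrFun h 0
    have h1 := congrFun h 1
    have h2 := congrFun h 2
    have h01 : c 0 ≠ c 1 := hc.ne (by decide)
    have h02 : c 0 ≠ c 2 := hc.ne (by decide)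
    have h12 : c 1 ≠ c 2 := hc.ne (by decide)
    dsimp only at h0 h1 h2
    obtain rfl : γ = γ' := by
      refine hR _ _ _ h01 h02 h12 ?_
      simp only [threeColDet]
      linear_combination (z (c 1) - z (c 2)) * h0 + (z (c 2) - z (c 0)) * h1
        + (z (c 0) - z (c 1)) * h2
    obtain rfl : β = β' := sub_eq_zero.1 <| hz _ _ _ h01 h02 h12 _
      (by linear_combination h0 - h1) (by linear_combination h0 - h2)
    obtain rfl : α = α' := by linear_combination h0
    rfl
  · rintro c - ⟨α, β, γ⟩ ⟨α', β', γ'⟩ h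
    simp only [Prod.mk.injEq] at h
    obtain ⟨h, rfl, rfl⟩ := h
    obtain rfl : α = α' := by linear_combination congrFun h 0
    rfl

/-- Base rows for the AOA(1,3,6,15). -/
def baseRows15 : Fin 15 → Fin 6 → ZMod 15 :=
  ![![0, 0, 0, 1, 0, 14],
    ![0, 1, 0, 12, 7, 8],
    ![0, 2, 0, 7, 5, 7],
    ![0, 3, 0, 2, 4, 10],
    ![0, 4, 0, 0, 14, 4],
    ![0, 5, 0, 11, 2, 12],
    ![0, 6, 0, 8, 9, 5],
    ![0, 7, 0, 6, 3, 0],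
    ![0, 8, 0, 3, 12, 6],
    ![0, 9, 0, 4, 6, 13],
    ![0, 10, 0, 5, 13, 2],
    ![0, 11, 0, 10, 1, 1],
    ![0, 12, 0, 9, 11, 9],
    ![0, 13, 0, 13, 10, 3],
    ![0, 14, 0, 14, 8, 11]]

/-- Base rows for the AOA(1,3,6,21). -/
def baseRows21 : Fin 21 → Fin 6 → ZMod 21 :=
  ![![0, 0, 0, 0, 0, 0],
    ![0, 1, 0, 11, 16, 5],
    ![0, 2, 0, 17, 18, 20],
    ![0, 3, 0, 9, 2, 17],
    ![0, 4, 0, 15, 20, 3],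
    ![0, 5, 0, 5, 10, 7],
    ![0, 6, 0, 2, 8, 15],
    ![0, 7, 0, 3, 6, 19],
    ![0, 8, 0, 8, 14, 9],
    ![0, 9, 0, 20, 9, 10],
    ![0, 10, 0, 7, 4, 13],
    ![0, 11, 0, 14, 17, 8],
    ![0, 12, 0, 1, 12, 11],
    ![0, 13, 0, 13, 7, 12],
    ![0, 14, 0, 18, 15, 2],
    ![0, 15, 0, 19, 13, 6],
    ![0, 16, 0, 16, 11, 14],
    ![0, 17, 0, 6, 1, 18],
    ![0, 18, 0, 12, 19, 4],
    ![0, 19, 0, 4, 3, 1],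
    ![0, 20, 0, 10, 5, 16]]

theorem aoa_1_3_6_15_and_21 : ExistsAOA 1 3 6 15 ∧ ExistsAOA 1 3 6 21 := by
  refine ⟨existsAOA_of_threeColDet ![0, 0, 1, 1, 14, 14] baseRows15 ?_ ?_,
    existsAOA_of_threeColDet ![0, 0, 1, 1, 5, 5] baseRows21 ?_ ?_⟩
  all_goals decide +kernel
end
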